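/- arXiv:1210.6429 — 3 statements merged into one kernel-verified Lean document; each statement's English description precedes it below -/
import Mathlib

section
/- Fix an integer ν ≥ 2. There exists a constant C = C(ν) > 0 such that the following holds for every prime p, every integer h with 3 ≤ h < 0.5·p^{1/ν} and every integer s: if there are at least N tuples of integers (x_1,…,x_ν,y_1,…,y_ν) with 1 ≤ x_i, y_i ≤ h satisfying (x_1+s)⋯(x_ν+s) ≡ (y_1+s)⋯(y_ν+s) ≢ 0 (mod p) and {x_1,…,x_ν} ∩ {y_1,…,y_ν} = ∅, then there are at least N·h^{−1}·exp(−C·log h/log log h) distinct non-constant polynomials R(Z) = A_1 Z^{ν−1} + ⋯ + A_{ν−1} Z + A_ν ∈ ℤ[Z] such that |A_i| ≤ binom(ν,i)·h^i for i = 1,…,ν and R(s) ≡ 0 (mod p). -/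
section

open Finset

theorem log_card_divisors_le {n : ℕ} (hn : n ≠ 0) {t : ℝ} (ht : 1 < t) :
    Real.log #n.divisors ≤
      t * Real.log (1 + Real.log n / Real.log 2) + Real.log n * (Real.log 2 / Real.log t) := by
  have hlt : 0 < Real.log t := Real.log_pos ht
  have hl2 : 0 < Real.log 2 := Real.log_pos one_lt_two
  have hn0 : 0 ≤ Real.log n := Real.log_natCast_nonneg n
  set B := Real.log (1 + Real.log n / Real.log 2) with hB
  have hB0 : 0 ≤ B := Real.log_nonneg (by simp; positivity)
  have key : ∀ q ∈ n.primeFactors, Real.log ((n.factorization q : ℝ) + 1) ≤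
      (if (q : ℝ) < t then B else 0) +
        n.factorization q * Real.log q * (Real.log 2 / Real.log t) := by
    intro q hq
    have hqp : q.Prime := Nat.prime_of_mem_primeFactors hq
    have hq2 : (2 : ℝ) ≤ q := by exact_mod_cast hqp.two_le
    have hlq : Real.log 2 ≤ Real.log q := Real.log_le_log two_pos hq2
    split_ifs with hqt
    · have hle : (n.factorization q : ℝ) * Real.log 2 ≤ Real.log n := by
        have : ((2 : ℕ) ^ n.factorization q : ℝ) ≤ n := by
          exact_mod_cast (Nat.pow_le_pow_left hqp.two_le _).trans (Nat.ordProj_le q hn)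
        simpa using Real.log_le_log (by positivity) this
      have : Real.log ((n.factorization q : ℝ) + 1) ≤ B := by
        apply Real.log_le_log (by positivity)
        rw [add_comm]
        gcongr
        rwa [le_div_iff₀ hl2]
      have : 0 ≤ (n.factorization q : ℝ) * Real.log q * (Real.log 2 / Real.log t) := by
        have : 0 ≤ Real.log q := hl2.le.trans hlq
        positivity
      linarith
    · rw [zero_add]
      have htq : Real.log t ≤ Real.log q := Real.log_le_log (by linarith) (not_lt.1 hqt)
      have h1 : Real.log ((n.factorization q : ℝ) + 1) ≤ n.factorization q * Real.log 2 := by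
        rw [← Real.log_pow]
        apply Real.log_le_log (by positivity)
        exact_mod_cast Nat.lt_two_pow_self
      refine h1.trans ?_
      rw [mul_assoc]
      gcongr
      rw [mul_div_assoc', le_div_iff₀ hlt, mul_comm]
      gcongr
  have hcard : (#{q ∈ n.primeFactors | ((q : ℕ) : ℝ) < t} : ℝ) ≤ t := by
    refine le_trans ?_ (Nat.floor_le (by linarith : 0 ≤ t))
    have : {q ∈ n.primeFactors | ((q : ℕ) : ℝ) < t} ⊆ Icc 1 ⌊t⌋₊ := by
      intro q hq
      rw [mem_filter] at hq
      exact mem_Icc.2 ⟨(Nat.prime_of_mem_primeFactors hq.1).pos, Nat.le_floor hq.2.le⟩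
    exact_mod_cast (card_le_card this).trans (by simp)
  rw [Nat.card_divisors hn, Nat.cast_prod, Real.log_prod (fun q _ => by positivity)]
  push_cast
  refine (sum_le_sum key).trans ?_
  rw [sum_add_distrib, ← sum_mul, ← sum_filter, sum_const, nsmul_eq_mul]
  have : ∑ q ∈ n.primeFactors, (n.factorization q : ℝ) * Real.log q = Real.log n := by
    rw [Real.log_nat_eq_sum_factorization]; rfl
  rw [this]
  gcongr

/-- The divisor bound, uniformly over `n ≤ h ^ ν`. -/
theorem exists_card_divisors_le_exp (ν : ℕ) :
    ∃ C : ℝ, 0 < C ∧ ∀ h : ℕ, 3 ≤ h → ∀ n : ℕ, n ≠ 0 → n ≤ h ^ ν →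
      (#n.divisors : ℝ) ≤ Real.exp (C * (Real.log h / Real.log (Real.log h))) := by
  have hl2 : 0 < Real.log 2 := Real.log_pos one_lt_two
  set c := Real.log (1 + ν / Real.log 2) with hc
  have hc0 : 0 ≤ c := Real.log_nonneg (by simp; positivity)
  refine ⟨4 * c + 16 + ν * (2 * Real.log 2), by positivity, fun h hh n hn hnh => ?_⟩
  have hL1 : 1 < Real.log h := by
    rw [Real.lt_log_iff_exp_lt (by positivity)]
    have : (3 : ℝ) ≤ h := by exact_mod_cast hh
    linarith [Real.exp_one_lt_d9]
  set L := Real.log h with hL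
  have hLn : Real.log n ≤ ν * L := by
    rw [hL, ← Real.log_pow]
    exact Real.log_le_log (by positivity) (by exact_mod_cast hnh)
  have hlL : 0 < Real.log L := Real.log_pos hL1
  obtain ⟨u, hu1, huL⟩ : ∃ u : ℝ, 1 < u ∧ u ^ 4 = L := by
    refine ⟨√√L, ?_, ?_⟩
    · rw [Real.lt_sqrt (by norm_num), one_pow, Real.lt_sqrt (by norm_num), one_pow]
      exact hL1
    · rw [show (4 : ℕ) = 2 * 2 by norm_num, pow_mul, Real.sq_sqrt (by positivity),
        Real.sq_sqrt (by positivity)]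
  have hlu : Real.log L = 4 * Real.log u := by rw [← huL, Real.log_pow]; norm_num
  have hlu0 : 0 < Real.log u := Real.log_pos hu1
  have hluu : Real.log u ≤ u := by linarith [Real.log_le_sub_one_of_pos (by linarith : 0 < u)]
  have hD := log_card_divisors_le hn (t := u ^ 2) (by nlinarith)
  have hB : Real.log (1 + Real.log n / Real.log 2) ≤ c + Real.log L := by
    rw [hc, ← Real.log_mul (by positivity) (by positivity)]
    have hn0 : 0 ≤ Real.log n := Real.log_natCast_nonneg n
    apply Real.log_le_log (by positivity)
    calc 1 + Real.log n / Real.log 2 ≤ L + ν * L / Real.log 2 := by gcongr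
      _ = _ := by ring
  have hpos : (0 : ℝ) < #n.divisors := by simpa [Nat.pos_iff_ne_zero] using hn
  rw [← Real.log_le_iff_le_exp hpos]
  refine hD.trans ?_
  have h1 : u ^ 2 * Real.log (1 + Real.log n / Real.log 2) ≤ (4 * c + 16) * (L / Real.log L) := by
    refine (mul_le_mul_of_nonneg_left hB (by positivity)).trans ?_
    rw [mul_div_assoc', le_div_iff₀ hlL, hlu, ← huL]
    calc u ^ 2 * (c + 4 * Real.log u) * (4 * Real.log u)
        ≤ u ^ 2 * (c * u + 4 * u) * (4 * u) := by
          gcongr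
          nlinarith
      _ = (4 * c + 16) * u ^ 4 := by ring
  have h2 : Real.log n * (Real.log 2 / Real.log (u ^ 2)) ≤
      ν * (2 * Real.log 2) * (L / Real.log L) := by
    calc _ ≤ ν * L * (Real.log 2 / Real.log (u ^ 2)) := by
          gcongr
          rw [Real.log_pow]; positivity
      _ = _ := by rw [Real.log_pow, hlu]; push_cast; field_simp; norm_num
  linarith

open Polynomial in
/-- The coefficients of `∏ (Z + x i) - ∏ (Z + y i)`, starting from that of `Z ^ (ν - 1)`. -/
noncomputable def prodDiffCoeff {ν : ℕ} (x y : Fin ν → ℤ) (j : Fin ν) : ℤ :=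
  (∏ i, (X + C (x i)) - ∏ i, (X + C (y i)) : ℤ[X]).coeff (ν - 1 - j)

open Polynomial in
theorem sum_prodDiffCoeff_mul_pow {ν : ℕ} (x y : Fin ν → ℤ) (z : ℤ) :
    ∑ j, prodDiffCoeff x y j * z ^ (ν - 1 - (j : ℕ)) = ∏ i, (z + x i) - ∏ i, (z + y i) := by
  rcases Nat.eq_zero_or_pos ν with rfl | hν
  · simp
  have hm (w : Fin ν → ℤ) : (∏ i, (X + C (w i)) : ℤ[X]).Monic :=
    monic_prod_of_monic _ _ fun i _ => monic_X_add_C _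
  have hd (w : Fin ν → ℤ) : (∏ i, (X + C (w i)) : ℤ[X]).degree = ν := by
    rw [degree_prod]; simp [degree_X_add_C, -eq_intCast]
  have hlt : (∏ i, (X + C (x i)) - ∏ i, (X + C (y i)) : ℤ[X]).degree < ν := by
    rw [← hd x]
    exact degree_sub_lt_left ((hd x).trans (hd y).symm) (hm x).ne_zero
      ((hm x).leadingCoeff.trans (hm y).leadingCoeff.symm)
  have hnd : (∏ i, (X + C (x i)) - ∏ i, (X + C (y i)) : ℤ[X]).natDegree < ν := by
    rcases eq_or_ne (∏ i, (X + C (x i)) - ∏ i, (X + C (y i)) : ℤ[X]) 0 with h0 | h0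
    · rwa [h0, natDegree_zero]
    · rwa [natDegree_lt_iff_degree_lt h0]
  have hev : (∏ i, (X + C (x i)) - ∏ i, (X + C (y i)) : ℤ[X]).eval z =
      ∏ i, (z + x i) - ∏ i, (z + y i) := by
    simp [eval_prod]
  rw [← hev, eval_eq_sum_range' hnd]
  simp only [prodDiffCoeff]
  rw [Fin.sum_univ_eq_sum_range
    (fun j => (∏ i, (X + C (x i)) - ∏ i, (X + C (y i)) : ℤ[X]).coeff (ν - 1 - j) * z ^ (ν - 1 - j)),
    Finset.sum_range_reflect
      (fun k => (∏ i, (X + C (x i)) - ∏ i, (X + C (y i)) : ℤ[X]).coeff k * z ^ k)]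

open Polynomial in
theorem abs_prodDiffCoeff_le {ν : ℕ} {x y : Fin ν → ℤ} {h : ℤ}
    (hx : ∀ i, 0 ≤ x i ∧ x i ≤ h) (hy : ∀ i, 0 ≤ y i ∧ y i ≤ h) (j : Fin ν) :
    |prodDiffCoeff x y j| ≤ (ν.choose ((j : ℕ) + 1) : ℤ) * h ^ ((j : ℕ) + 1) := by
  have hj := j.2
  have key (w : Fin ν → ℤ) (hw : ∀ i, 0 ≤ w i ∧ w i ≤ h) :
      0 ≤ (∏ i, (X + C (w i)) : ℤ[X]).coeff (ν - 1 - j) ∧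
      (∏ i, (X + C (w i)) : ℤ[X]).coeff (ν - 1 - j) ≤
        (ν.choose ((j : ℕ) + 1) : ℤ) * h ^ ((j : ℕ) + 1) := by
    rw [Finset.prod_X_add_C_coeff _ _ (by simp; omega), Finset.card_univ, Fintype.card_fin,
      show ν - (ν - 1 - j) = (j : ℕ) + 1 by omega]
    refine ⟨Finset.sum_nonneg fun t _ => Finset.prod_nonneg fun i _ => (hw i).1, ?_⟩
    refine (Finset.sum_le_card_nsmul _ _ (h ^ ((j : ℕ) + 1)) fun t ht => ?_).trans ?_
    · rw [← (Finset.mem_powersetCard.1 ht).2]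
      exact (Finset.prod_le_prod (fun i _ => (hw i).1) fun i _ => (hw i).2).trans_eq (by simp)
    · simp
  have h1 := key x hx
  have h2 := key y hy
  rw [prodDiffCoeff, coeff_sub, abs_sub_le_iff]
  omega

theorem mem_range_of_prod_add_eq {ι : Type*} [Fintype ι] {x x' : ι → ℤ}
    (h : ∀ z, ∏ i, (z + x i) = ∏ i, (z + x' i)) (i : ι) : ∃ k, x' k = x i := by
  have h0 : ∏ k, (-x i + x' k) = 0 := by
    rw [← h]
    exact Finset.prod_eq_zero (Finset.mem_univ i) (by simp)
  obtain ⟨k, -, hk⟩ := Finset.prod_eq_zero_iff.1 h0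
  exact ⟨k, by linarith⟩

/-- A set of pairs of disjoint tuples from `[1, h]` that share the value of `x i₀` and the
polynomial `∏ (Z + x i) - ∏ (Z + y i)` is small, provided integers have few divisors. -/
theorem card_le_of_prodDiffCoeff_eq {ν h D : ℕ} (i₀ : Fin ν)
    (hD : ∀ n : ℕ, n ≠ 0 → n ≤ h ^ ν → #n.divisors ≤ D)
    (F : Finset ((Fin ν → ℤ) × (Fin ν → ℤ))) (A : Fin ν → ℤ) (a : ℤ)
    (hbd : ∀ q ∈ F, (∀ i, 1 ≤ q.1 i ∧ q.1 i ≤ (h : ℤ)) ∧ (∀ i, 1 ≤ q.2 i ∧ q.2 i ≤ (h : ℤ)))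
    (hdisj : ∀ q ∈ F, ∀ i j, q.1 i ≠ q.2 j)
    (hA : ∀ q ∈ F, prodDiffCoeff q.1 q.2 = A) (ha : ∀ q ∈ F, q.1 i₀ = a) :
    #F ≤ (2 * ν * D) ^ ν := by
  classical
  set r : ℤ := ∑ j, A j * (-a) ^ (ν - 1 - (j : ℕ)) with hr
  set T : Finset ℤ := r.natAbs.divisors.image (fun d : ℕ => a + (d : ℤ)) ∪
    r.natAbs.divisors.image (fun d : ℕ => a - (d : ℤ)) with hT
  have hrq : ∀ q ∈ F, r = -∏ i, (-a + q.2 i) := by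
    intro q hq
    rw [hr, ← hA q hq, sum_prodDiffCoeff_mul_pow, Finset.prod_eq_zero (i := i₀) (mem_univ _)]
    · ring
    · rw [ha q hq]; ring
  rcases F.eq_empty_or_nonempty with rfl | ⟨q₀, hq₀⟩
  · simp
  have hr0 : r ≠ 0 := by
    rw [hrq q₀ hq₀, neg_ne_zero, Finset.prod_ne_zero_iff]
    intro i _ hi
    exact hdisj q₀ hq₀ i₀ i (by rw [ha q₀ hq₀]; linarith)
  have hrle : r.natAbs ≤ h ^ ν := by
    have h1 : r.natAbs = ∏ i, (-a + q₀.2 i).natAbs := by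
      rw [hrq q₀ hq₀, Int.natAbs_neg, ← Int.natAbsHom_apply, map_prod]; rfl
    rw [h1]
    refine (Finset.prod_le_pow_card _ _ h fun i _ => ?_).trans (by simp)
    have h2 := (hbd q₀ hq₀).1 i₀
    have h3 := (hbd q₀ hq₀).2 i
    rw [ha q₀ hq₀] at h2
    omega
  have hTD : #T ≤ 2 * D := by
    have := hD r.natAbs (by simpa using hr0) hrle
    refine (card_union_le _ _).trans ?_
    have h1 := card_image_le (s := r.natAbs.divisors) (f := fun d : ℕ => a + (d : ℤ))
    have h2 := card_image_le (s := r.natAbs.divisors) (f := fun d : ℕ => a - (d : ℤ))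
    omega
  have hmaps : ∀ q ∈ F, q.2 ∈ Fintype.piFinset (fun _ : Fin ν => T) := by
    intro q hq
    rw [Fintype.mem_piFinset]
    intro i
    have hdvd : (-a + q.2 i).natAbs ∈ r.natAbs.divisors := by
      rw [Nat.mem_divisors]
      refine ⟨Int.natAbs_dvd_natAbs.2 ?_, by simpa using hr0⟩
      rw [hrq q hq, dvd_neg]
      exact Finset.dvd_prod_of_mem _ (mem_univ i)
    rw [hT, mem_union, mem_image, mem_image]
    rcases le_total 0 (-a + q.2 i) with h0 | h0
    · exact Or.inl ⟨_, hdvd, by omega⟩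
    · exact Or.inr ⟨_, hdvd, by omega⟩
  have hfib : ∀ y ∈ Fintype.piFinset (fun _ : Fin ν => T), #{q ∈ F | q.2 = y} ≤ ν ^ ν := by
    intro y _
    rcases ({q ∈ F | q.2 = y} : Finset _).eq_empty_or_nonempty with he | ⟨q₁, hq₁⟩
    · rw [he]; simp
    rw [mem_filter] at hq₁
    have hle : #{q ∈ F | q.2 = y} ≤ #(Fintype.piFinset fun _ : Fin ν => univ.image q₁.1) := by
      refine card_le_card_of_injOn Prod.fst (fun q hq => ?_) (fun q hq q' hq' he => ?_)
      · rw [mem_coe, mem_filter] at hq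
        rw [mem_coe, Fintype.mem_piFinset]
        intro i
        have heq (z : ℤ) : ∏ i, (z + q.1 i) = ∏ i, (z + q₁.1 i) := by
          have h1 := sum_prodDiffCoeff_mul_pow q.1 q.2 z
          have h2 := sum_prodDiffCoeff_mul_pow q₁.1 q₁.2 z
          rw [hA q hq.1, hq.2] at h1
          rw [hA q₁ hq₁.1, hq₁.2] at h2
          linarith
        obtain ⟨k, hk⟩ := mem_range_of_prod_add_eq heq i
        exact mem_image.2 ⟨k, mem_univ k, hk⟩
      · rw [mem_coe, mem_filter] at hq hq'
        exact Prod.ext he (hq.2.trans hq'.2.symm)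
    refine hle.trans ?_
    rw [Fintype.card_piFinset_const]
    exact Nat.pow_le_pow_left (card_image_le.trans (by simp)) _
  refine (card_le_mul_card_image_of_maps_to hmaps _ hfib).trans ?_
  rw [Fintype.card_piFinset_const, mul_right_comm, mul_comm (2 * D), mul_pow]
  gcongr

theorem exists_prodDiffCoeff_ne_zero {ν h p : ℕ} (hν : 0 < ν) (hp : h ^ ν < p) {s : ℤ}
    {x y : Fin ν → ℤ} (hx : ∀ i, 1 ≤ x i ∧ x i ≤ (h : ℤ)) (hy : ∀ i, 1 ≤ y i ∧ y i ≤ (h : ℤ))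
    (hxy : ∀ i j, x i ≠ y j)
    (hdvd : (p : ℤ) ∣ ∑ j, prodDiffCoeff x y j * s ^ (ν - 1 - (j : ℕ))) :
    ∃ j : Fin ν, (j : ℕ) + 1 < ν ∧ prodDiffCoeff x y j ≠ 0 := by
  by_contra! hcon
  let l : Fin ν := ⟨ν - 1, by omega⟩
  have hl : ∀ j, j ≠ l → prodDiffCoeff x y j = 0 := by
    intro j hj
    refine hcon j ?_
    have := j.2
    have : (j : ℕ) ≠ ν - 1 := fun hh => hj (Fin.ext hh)
    omega
  have hsum (z : ℤ) : ∑ j, prodDiffCoeff x y j * z ^ (ν - 1 - (j : ℕ)) = prodDiffCoeff x y l := by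
    rw [Finset.sum_eq_single l (fun j _ hj => by rw [hl j hj, zero_mul]) (by simp)]
    simp [l]
  rw [hsum] at hdvd
  have hb := abs_prodDiffCoeff_le (fun i => ⟨by linarith [(hx i).1], (hx i).2⟩)
    (fun i => ⟨by linarith [(hy i).1], (hy i).2⟩) l
  have hl0 : prodDiffCoeff x y l = 0 := by
    apply Int.eq_zero_of_abs_lt_dvd hdvd
    refine hb.trans_lt ?_
    simp only [l, Nat.sub_add_cancel hν, Nat.choose_self, Nat.cast_one, one_mul]
    exact_mod_cast hp
  obtain ⟨k, hk⟩ := mem_range_of_prod_add_eq (x := x) (x' := y)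
    (fun z => sub_eq_zero.1 (by rw [← sum_prodDiffCoeff_mul_pow, hsum, hl0])) l
  exact hxy l k hk.symm

theorem pow_lt_of_lt_half_mul_rpow {ν h p : ℕ} (hν : 0 < ν)
    (hlt : (h : ℝ) < 0.5 * (p : ℝ) ^ ((1 : ℝ) / ν)) : h ^ ν < p := by
  have h1 : (h : ℝ) < (p : ℝ) ^ ((1 : ℝ) / ν) := by
    have : 0 ≤ (p : ℝ) ^ ((1 : ℝ) / ν) := by positivity
    linarith
  have h2 := pow_lt_pow_left₀ h1 (by positivity) hν.ne'
  rw [one_div, Real.rpow_inv_natCast_pow (by positivity) hν.ne'] at h2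
  exact_mod_cast h2

theorem dvd_sum_prodDiffCoeff {ν p : ℕ} {s : ℤ} {x y : Fin ν → ℤ}
    (h : ∏ i, ((x i : ZMod p) + (s : ZMod p)) = ∏ i, ((y i : ZMod p) + (s : ZMod p))) :
    (p : ℤ) ∣ ∑ j, prodDiffCoeff x y j * s ^ (ν - 1 - (j : ℕ)) := by
  rw [sum_prodDiffCoeff_mul_pow, ← ZMod.intCast_zmod_eq_zero_iff_dvd]
  push_cast
  simp only [add_comm (s : ZMod p)]
  rw [h, sub_self]

end


/-- For fixed `ν ≥ 2` there is `C = C(ν) > 0` such that for every prime `p`,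
every integer `3 ≤ h < 0.5·p^{1/ν}` and every integer `s`: if the congruence
`(x₁+s)⋯(x_ν+s) ≡ (y₁+s)⋯(y_ν+s) ≢ 0 (mod p)` has at least `N` solutions with `1 ≤ xᵢ, yᵢ ≤ h`
and `{x₁,…,x_ν} ∩ {y₁,…,y_ν} = ∅`, then there are at least `N·h⁻¹·exp(−C log h / log log h)`
distinct non-constant polynomials `R(Z) = A₁Z^{ν−1} + ⋯ + A_ν ∈ ℤ[Z]` with
`|A_i| ≤ binom(ν,i)·h^i` and `R(s) ≡ 0 (mod p)`. -/
theorem stmt16 (ν : ℕ) (hν : 2 ≤ ν) :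
    ∃ C : ℝ, 0 < C ∧ ∀ p : ℕ, p.Prime → ∀ h : ℕ, 3 ≤ h →
      (h : ℝ) < 0.5 * (p : ℝ) ^ ((1 : ℝ) / ν) → ∀ s : ℤ, ∀ N : ℕ,
      N ≤ Set.ncard {xy : (Fin ν → ℤ) × (Fin ν → ℤ) |
          (∀ i, 1 ≤ xy.1 i ∧ xy.1 i ≤ (h : ℤ)) ∧
          (∀ i, 1 ≤ xy.2 i ∧ xy.2 i ≤ (h : ℤ)) ∧
          (∏ i, ((xy.1 i : ZMod p) + (s : ZMod p))) =
            (∏ i, ((xy.2 i : ZMod p) + (s : ZMod p))) ∧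
          (∏ i, ((xy.1 i : ZMod p) + (s : ZMod p))) ≠ 0 ∧
          (∀ i j, xy.1 i ≠ xy.2 j)} →
      (Set.ncard {A : Fin ν → ℤ |
          (∃ j : Fin ν, (j : ℕ) + 1 < ν ∧ A j ≠ 0) ∧
          (∀ j : Fin ν, |A j| ≤ (ν.choose ((j : ℕ) + 1) : ℤ) * (h : ℤ) ^ ((j : ℕ) + 1)) ∧
          ((p : ℤ) ∣ ∑ j : Fin ν, A j * s ^ (ν - 1 - (j : ℕ)))} : ℝ)
        ≥ (N : ℝ) * (h : ℝ)⁻¹ * Real.exp (-(C * Real.log h / Real.log (Real.log h))) := by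
  classical
  obtain ⟨C₀, hC₀, hdiv⟩ := exists_card_divisors_le_exp ν
  have h2ν : 0 < Real.log (2 * ν) := Real.log_pos (by exact_mod_cast (by omega : 1 < 2 * ν))
  refine ⟨ν * C₀ + ν * Real.log (2 * ν), by positivity, fun p _ h hh hlt s N hN => ?_⟩
  have hp := pow_lt_of_lt_half_mul_rpow (by omega) hlt
  set S : Set ((Fin ν → ℤ) × (Fin ν → ℤ)) := {xy | _} with hS
  set R : Set (Fin ν → ℤ) := {A | _} with hR
  have hSfin : S.Finite := by
    refine Set.Finite.subset (Set.finite_Icc ((fun _ => 1, fun _ => 1) :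
      (Fin ν → ℤ) × (Fin ν → ℤ)) (fun _ => h, fun _ => h)) fun q hq => ?_
    exact ⟨⟨fun i => (hq.1 i).1, fun i => (hq.2.1 i).1⟩, fun i => (hq.1 i).2,
      fun i => (hq.2.1 i).2⟩
  have hRfin : R.Finite := by
    refine Set.Finite.subset (Set.finite_Icc
      (fun j : Fin ν => -((ν.choose ((j : ℕ) + 1) : ℤ) * (h : ℤ) ^ ((j : ℕ) + 1)))
      (fun j : Fin ν => (ν.choose ((j : ℕ) + 1) : ℤ) * (h : ℤ) ^ ((j : ℕ) + 1))) fun A hA => ?_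
    exact ⟨fun j => (abs_le.1 (hA.2.1 j)).1, fun j => (abs_le.1 (hA.2.1 j)).2⟩
  set E := Real.log h / Real.log (Real.log h) with hE
  set D := ⌊Real.exp (C₀ * E)⌋₊ with hDdef
  have hD : ∀ n : ℕ, n ≠ 0 → n ≤ h ^ ν → n.divisors.card ≤ D := fun n hn hnh =>
    Nat.le_floor (hdiv h hh n hn hnh)
  let i₀ : Fin ν := ⟨0, by omega⟩
  have hmaps : ∀ q ∈ hSfin.toFinset, (prodDiffCoeff q.1 q.2, q.1 i₀) ∈
      hRfin.toFinset ×ˢ Finset.Icc (1 : ℤ) h := by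
    intro q hq
    rw [Set.Finite.mem_toFinset] at hq
    obtain ⟨hx, hy, heq, -, hne⟩ := hq
    have hd := dvd_sum_prodDiffCoeff heq
    rw [Finset.mem_product, Set.Finite.mem_toFinset, Finset.mem_Icc]
    exact ⟨⟨exists_prodDiffCoeff_ne_zero (by omega) hp hx hy hne hd,
      abs_prodDiffCoeff_le (fun i => ⟨by linarith [(hx i).1], (hx i).2⟩)
        (fun i => ⟨by linarith [(hy i).1], (hy i).2⟩), hd⟩, hx i₀⟩
  have hcount := Finset.card_le_mul_card_image_of_maps_to hmaps ((2 * ν * D) ^ ν) fun b _ => by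
    refine card_le_of_prodDiffCoeff_eq i₀ hD _ b.1 b.2 ?_ ?_ ?_ ?_ <;> intro q hq <;>
      rw [Finset.mem_filter, Set.Finite.mem_toFinset] at hq
    · exact ⟨hq.1.1, hq.1.2.1⟩
    · exact hq.1.2.2.2.2
    · rw [← hq.2]
    · rw [← hq.2]
  rw [Finset.card_product, ← Set.ncard_eq_toFinset_card S hSfin, ← Set.ncard_eq_toFinset_card R hRfin, Int.card_Icc]
    at hcount
  have hNR : (N : ℝ) ≤ (2 * ν * D) ^ ν * (R.ncard * h) := by
    have := hN.trans hcount
    simp only [add_sub_cancel_right, Int.toNat_natCast] at this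
    exact_mod_cast this
  have hL1 : 1 < Real.log h := by
    rw [Real.lt_log_iff_exp_lt (by positivity)]
    have : (3 : ℝ) ≤ h := by exact_mod_cast hh
    linarith [Real.exp_one_lt_d9]
  have hE1 : 1 ≤ E := by
    rw [hE, le_div_iff₀ (Real.log_pos hL1), one_mul]
    linarith [Real.log_le_sub_one_of_pos (by linarith : 0 < Real.log h)]
  have hexp : (2 * ν * D : ℝ) ^ ν ≤ Real.exp ((ν * C₀ + ν * Real.log (2 * ν)) * E) := by
    have h1 : (2 * ν : ℝ) ≤ Real.exp (Real.log (2 * ν) * E) := by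
      rw [← Real.log_le_iff_le_exp (by positivity)]
      exact le_mul_of_one_le_right h2ν.le hE1
    calc (2 * ν * D : ℝ) ^ ν
        ≤ (Real.exp (Real.log (2 * ν) * E) * Real.exp (C₀ * E)) ^ ν := by
          gcongr
          exact Nat.floor_le (Real.exp_pos _).le
      _ = _ := by rw [← Real.exp_add, ← Real.exp_nat_mul]; ring_nf
  have hh0 : (0 : ℝ) < h := by positivity
  rw [ge_iff_le, mul_div_assoc, ← hE, Real.exp_neg, ← div_eq_mul_inv, ← div_eq_mul_inv, div_div,
    div_le_iff₀ (by positivity)]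
  calc (N : ℝ) ≤ (2 * ν * D) ^ ν * (R.ncard * h) := hNR
    _ ≤ Real.exp ((ν * C₀ + ν * Real.log (2 * ν)) * E) * (R.ncard * h) := by gcongr
    _ = _ := by ring
end

section
/- There exist absolute constants C₀, C₁ > 0 with the following property: for every prime p, every positive integer h, every integer s, and every integer T with T ≥ C₀·max{h, h⁴·p^{−1/2}, h⁶·p^{−1}}, if there are at least T distinct integer triples (U,V,W) with |U| ≤ 3h, |V| ≤ 3h², |W| ≤ h³ and U·s² + V·s + W ≡ 0 (mod p), then there exist integers r and t with 0 < |r| ≤ C₁·h^{3/2}·T^{−1/2}, |t| ≤ C₁·h^{5/2}·T^{−1/2}, and r·s ≡ t (mod p). -/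
/-- If `f` vanishes mod `m` on `S` and every residue mod `m` is attained by some `ρ` whose
translates of `S` stay inside `Q`, then the translates are disjoint. -/
lemma card_mul_le_card_of_translates {G : Type*} [AddCommGroup G] (f : G →+ ℤ) (m : ℕ)
    (S Q : Finset G) (hS : ∀ x ∈ S, (m : ℤ) ∣ f x)
    (hQ : ∀ j : ℕ, j < m → ∃ ρ, (m : ℤ) ∣ f ρ - j ∧ ∀ x ∈ S, x + ρ ∈ Q) :
    S.card * m ≤ Q.card := by
  choose! ρ h1 h2 using hQ
  rw [← Finset.card_range m, ← Finset.card_product]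
  refine Finset.card_le_card_of_injOn (fun z => z.1 + ρ z.2) ?_ ?_
  · rintro ⟨x, j⟩ hz
    simp only [Finset.coe_product, Set.mem_prod, Finset.mem_coe, Finset.mem_range] at hz
    exact h2 j hz.2 x hz.1
  · rintro ⟨x, j⟩ hz ⟨y, i⟩ hw hzw
    simp only [Finset.coe_product, Set.mem_prod, Finset.mem_coe, Finset.mem_range] at hz hw
    dsimp only at hzw
    have hf : f x + f (ρ j) = f y + f (ρ i) := by rw [← map_add, ← map_add, hzw]
    have hd : (m : ℤ) ∣ (i : ℤ) - j := by
      have := ((hS x hz.1).sub (hS y hw.1)).add ((h1 j hz.2).sub (h1 i hw.2))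
      rwa [show f x - f y + (f (ρ j) - j - (f (ρ i) - i)) = (i : ℤ) - j by linarith] at this
    have hij : j = i := by
      have := (Nat.modEq_iff_dvd.mpr hd)
      exact Nat.ModEq.eq_of_lt_of_lt this hz.2 hw.2
    subst hij
    simpa using hzw

lemma abs_sub_floor_combination_le {D z a b c u v w : ℤ} (hD : D ≠ 0)
    (h : D * z = a * u + b * v + c * w) :
    |z - (a / D * u + b / D * v + c / D * w)| ≤ |u| + |v| + |w| := by
  have hDp : 0 < |D| := abs_pos.mpr hD
  have key : D * (z - (a / D * u + b / D * v + c / D * w))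
      = a % D * u + b % D * v + c % D * w := by
    rw [Int.emod_def, Int.emod_def, Int.emod_def]
    linear_combination h
  have hr : ∀ e y : ℤ, |e % D * y| ≤ |D| * |y| := fun e y => by
    rw [abs_mul, abs_of_nonneg (Int.emod_nonneg e hD)]
    exact mul_le_mul_of_nonneg_right (Int.emod_lt_abs e hD).le (abs_nonneg y)
  refine le_of_mul_le_mul_left ?_ hDp
  rw [← abs_mul, key]
  calc _ ≤ |a % D * u| + |b % D * v| + |c % D * w| := abs_add_three _ _ _
    _ ≤ |D| * |u| + |D| * |v| + |D| * |w| := by gcongr <;> exact hr _ _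
    _ = _ := by ring

lemma card_Icc_neg_self (A : ℕ) : (Finset.Icc (-(A : ℤ)) A).card = 2 * A + 1 := by
  rw [Int.card_Icc]; omega

/-- Points of a planar lattice of index `m` in a box containing two independent ones. -/
lemma card_mul_le_of_plane_lattice (m : ℕ) (A B : ℕ) (α β b c : ℤ)
    (hbc : (m : ℤ) ∣ α * b + β * c - 1) (S : Finset (ℤ × ℤ))
    (hS : ∀ x ∈ S, |x.1| ≤ A ∧ |x.2| ≤ B ∧ (m : ℤ) ∣ α * x.1 + β * x.2)
    {u v : ℤ × ℤ} (hu : u ∈ S) (hv : v ∈ S) (hD : u.1 * v.2 - u.2 * v.1 ≠ 0) :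
    S.card * m ≤ (6 * A + 1) * (6 * B + 1) := by
  let f : ℤ × ℤ →+ ℤ :=
    { toFun := fun x => α * x.1 + β * x.2
      map_zero' := by simp
      map_add' := fun x y => by simp only [Prod.fst_add, Prod.snd_add]; ring }
  have := card_mul_le_card_of_translates f m S
    (Finset.Icc (-((3 * A : ℕ) : ℤ)) (3 * A : ℕ) ×ˢ Finset.Icc (-((3 * B : ℕ) : ℤ)) (3 * B : ℕ))
    (fun x hx => (hS x hx).2.2) ?_
  · rw [Finset.card_product, card_Icc_neg_self, card_Icc_neg_self] at this
    calc _ ≤ _ := this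
      _ = _ := by ring
  intro j _
  set D := u.1 * v.2 - u.2 * v.1 with hDdef
  set k := (j * b * v.2 - j * c * v.1) / D
  set l := (u.1 * (j * c) - u.2 * (j * b)) / D
  obtain ⟨hu1, hu2, hu3⟩ := hS u hu
  obtain ⟨hv1, hv2, hv3⟩ := hS v hv
  have e1 := abs_sub_floor_combination_le (D := D) (z := j * b) (a := j * b * v.2 - j * c * v.1)
    (b := u.1 * (j * c) - u.2 * (j * b)) (c := 0) (u := u.1) (v := v.1) (w := 0) hD
    (by rw [hDdef]; ring)
  have e2 := abs_sub_floor_combination_le (D := D) (z := j * c) (a := j * b * v.2 - j * c * v.1)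
    (b := u.1 * (j * c) - u.2 * (j * b)) (c := 0) (u := u.2) (v := v.2) (w := 0) hD
    (by rw [hDdef]; ring)
  simp only [Int.zero_ediv, zero_mul, add_zero, abs_zero] at e1 e2
  refine ⟨(j * b - (k * u.1 + l * v.1), j * c - (k * u.2 + l * v.2)), ?_, ?_⟩
  · have : f (j * b - (k * u.1 + l * v.1), j * c - (k * u.2 + l * v.2)) - j
        = j * (α * b + β * c - 1) - k * (α * u.1 + β * u.2) - l * (α * v.1 + β * v.2) := by
      simp only [f, AddMonoidHom.coe_mk, ZeroHom.coe_mk]; ring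
    rw [this]
    exact ((hbc.mul_left _).sub (hu3.mul_left _)).sub (hv3.mul_left _)
  · intro x hx
    obtain ⟨hx1, hx2, -⟩ := hS x hx
    rw [abs_le] at hx1 hx2
    have e1' := abs_le.mp e1
    have e2' := abs_le.mp e2
    simp only [Finset.mem_product, Finset.mem_Icc, Prod.fst_add, Prod.snd_add, Nat.cast_mul,
      Nat.cast_ofNat]
    refine ⟨⟨?_, ?_⟩, ?_, ?_⟩ <;> linarith

/-- Points with pairwise determinants divisible by `p` in a box, not all collinear. -/
lemma card_mul_le_of_prime_dvd_det {p : ℕ} (hp : p.Prime) (A B : ℕ) (S : Finset (ℤ × ℤ))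
    (hS : ∀ x ∈ S, |x.1| ≤ A ∧ |x.2| ≤ B)
    (hdet : ∀ x ∈ S, ∀ y ∈ S, (p : ℤ) ∣ x.1 * y.2 - x.2 * y.1)
    {u v : ℤ × ℤ} (hu : u ∈ S) (hv : v ∈ S) (hD : u.1 * v.2 - u.2 * v.1 ≠ 0) :
    S.card * p ≤ (6 * A + 1) * (6 * B + 1) := by
  have hinv : ∀ a : ℤ, ¬ (p : ℤ) ∣ a → ∃ b, (p : ℤ) ∣ a * b - 1 := fun a ha => by
    obtain ⟨k, l, h⟩ := (Nat.prime_iff_prime_int.mp hp).coprime_iff_not_dvd.mpr ha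
    exact ⟨l, -k, by linear_combination h⟩
  by_cases h : ∀ x ∈ S, (p : ℤ) ∣ x.1 ∧ (p : ℤ) ∣ x.2
  · exact card_mul_le_of_plane_lattice p A B 1 0 1 0 (by simp) S
      (fun x hx => ⟨(hS x hx).1, (hS x hx).2, by simpa using (h x hx).1⟩) hu hv hD
  · push Not at h
    obtain ⟨x, hx, hx'⟩ := h
    obtain ⟨b, c, hbc⟩ : ∃ b c, (p : ℤ) ∣ -x.2 * b + x.1 * c - 1 := by
      by_cases h1 : (p : ℤ) ∣ x.1
      · obtain ⟨b, hb⟩ := hinv _ (hx' h1)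
        exact ⟨-b, 0, by simpa using hb⟩
      · obtain ⟨c, hc⟩ := hinv _ h1
        exact ⟨0, c, by simpa using hc⟩
    refine card_mul_le_of_plane_lattice p A B _ _ b c hbc S
      (fun y hy => ⟨(hS y hy).1, (hS y hy).2, ?_⟩) hu hv hD
    convert hdet x hx y hy using 1
    ring

lemma card_mul_le_of_det_ne_zero (p h : ℕ) (s : ℤ) (S : Finset (ℤ × ℤ × ℤ))
    (hS : ∀ x ∈ S, |x.1| ≤ 3 * (h : ℤ) ∧ |x.2.1| ≤ 3 * (h : ℤ) ^ 2 ∧ |x.2.2| ≤ (h : ℤ) ^ 3 ∧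
      (p : ℤ) ∣ x.1 * s ^ 2 + x.2.1 * s + x.2.2)
    {u v w : ℤ × ℤ × ℤ} (hu : u ∈ S) (hv : v ∈ S) (hw : w ∈ S)
    (hD : (u.2.1 * v.2.2 - u.2.2 * v.2.1) * w.1 + (u.2.2 * v.1 - u.1 * v.2.2) * w.2.1
      + (u.1 * v.2.1 - u.2.1 * v.1) * w.2.2 ≠ 0) :
    S.card * p ≤ (24 * h + 1) * ((24 * h ^ 2 + 1) * (8 * h ^ 3 + 1)) := by
  let f : ℤ × ℤ × ℤ →+ ℤ :=
    { toFun := fun x => x.1 * s ^ 2 + x.2.1 * s + x.2.2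
      map_zero' := by simp
      map_add' := fun x y => by simp only [Prod.fst_add, Prod.snd_add]; ring }
  have := card_mul_le_card_of_translates f p S
    (Finset.Icc (-((12 * h : ℕ) : ℤ)) (12 * h : ℕ) ×ˢ
      Finset.Icc (-((12 * h ^ 2 : ℕ) : ℤ)) (12 * h ^ 2 : ℕ) ×ˢ
      Finset.Icc (-((4 * h ^ 3 : ℕ) : ℤ)) (4 * h ^ 3 : ℕ))
    (fun x hx => (hS x hx).2.2.2) ?_
  · rw [Finset.card_product, Finset.card_product, card_Icc_neg_self, card_Icc_neg_self,
      card_Icc_neg_self] at this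
    calc _ ≤ _ := this
      _ = _ := by ring
  intro j _
  set D := (u.2.1 * v.2.2 - u.2.2 * v.2.1) * w.1 + (u.2.2 * v.1 - u.1 * v.2.2) * w.2.1
      + (u.1 * v.2.1 - u.2.1 * v.1) * w.2.2 with hDdef
  obtain ⟨hu1, hu2, hu3, hu4⟩ := hS u hu
  obtain ⟨hv1, hv2, hv3, hv4⟩ := hS v hv
  obtain ⟨hw1, hw2, hw3, hw4⟩ := hS w hw
  have e1 := abs_sub_floor_combination_le (D := D) (z := 0) (a := j * (v.1 * w.2.1 - v.2.1 * w.1))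
    (b := j * (w.1 * u.2.1 - w.2.1 * u.1)) (c := j * (u.1 * v.2.1 - u.2.1 * v.1))
    (u := u.1) (v := v.1) (w := w.1) hD (by ring)
  have e2 := abs_sub_floor_combination_le (D := D) (z := 0) (a := j * (v.1 * w.2.1 - v.2.1 * w.1))
    (b := j * (w.1 * u.2.1 - w.2.1 * u.1)) (c := j * (u.1 * v.2.1 - u.2.1 * v.1))
    (u := u.2.1) (v := v.2.1) (w := w.2.1) hD (by ring)
  have e3 := abs_sub_floor_combination_le (D := D) (z := j) (a := j * (v.1 * w.2.1 - v.2.1 * w.1))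
    (b := j * (w.1 * u.2.1 - w.2.1 * u.1)) (c := j * (u.1 * v.2.1 - u.2.1 * v.1))
    (u := u.2.2) (v := v.2.2) (w := w.2.2) hD (by rw [hDdef]; ring)
  set k := j * (v.1 * w.2.1 - v.2.1 * w.1) / D
  set l := j * (w.1 * u.2.1 - w.2.1 * u.1) / D
  set q := j * (u.1 * v.2.1 - u.2.1 * v.1) / D
  refine ⟨(0 - (k * u.1 + l * v.1 + q * w.1), 0 - (k * u.2.1 + l * v.2.1 + q * w.2.1),
    j - (k * u.2.2 + l * v.2.2 + q * w.2.2)), ?_, ?_⟩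
  · have : f (0 - (k * u.1 + l * v.1 + q * w.1), 0 - (k * u.2.1 + l * v.2.1 + q * w.2.1),
        j - (k * u.2.2 + l * v.2.2 + q * w.2.2)) - j
        = -(k * (u.1 * s ^ 2 + u.2.1 * s + u.2.2) + l * (v.1 * s ^ 2 + v.2.1 * s + v.2.2)
          + q * (w.1 * s ^ 2 + w.2.1 * s + w.2.2)) := by
      simp only [f, AddMonoidHom.coe_mk, ZeroHom.coe_mk]; ring
    rw [this, dvd_neg]
    exact ((hu4.mul_left _).add (hv4.mul_left _)).add (hw4.mul_left _)
  · intro x hx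
    obtain ⟨hx1, hx2, hx3, -⟩ := hS x hx
    rw [abs_le] at hx1 hx2 hx3
    have e1' := abs_le.mp e1
    have e2' := abs_le.mp e2
    have e3' := abs_le.mp e3
    simp only [Finset.mem_product, Finset.mem_Icc, Prod.fst_add, Prod.snd_add, Nat.cast_mul,
      Nat.cast_ofNat, Nat.cast_pow]
    refine ⟨⟨?_, ?_⟩, ⟨?_, ?_⟩, ?_, ?_⟩ <;> linarith

/-- Every nonzero integer vector in dimension three is a multiple of a primitive one. -/
lemma exists_primitive_triple (x y z : ℤ) (hne : ¬ (x = 0 ∧ y = 0 ∧ z = 0)) :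
    ∃ g x' y' z' a b c : ℤ, g ≠ 0 ∧ x = g * x' ∧ y = g * y' ∧ z = g * z' ∧
      a * x' + b * y' + c * z' = 1 := by
  obtain ⟨d, hd⟩ := IsPrincipalIdealRing.principal (Ideal.span ({x, y, z} : Set ℤ))
  have hd' : Ideal.span ({x, y, z} : Set ℤ) = Ideal.span {d} := hd
  have hmem : ∀ e ∈ ({x, y, z} : Set ℤ), d ∣ e := fun e he =>
    Ideal.mem_span_singleton.mp (hd' ▸ Ideal.subset_span he)
  obtain ⟨x', hx⟩ := hmem x (by simp)
  obtain ⟨y', hy⟩ := hmem y (by simp)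
  obtain ⟨z', hz⟩ := hmem z (by simp)
  have hd0 : d ≠ 0 := by
    rintro rfl
    exact hne (by simp [hx, hy, hz])
  have : d ∈ Ideal.span ({x, y, z} : Set ℤ) := hd' ▸ Ideal.mem_span_singleton_self d
  obtain ⟨a, b, c, habc⟩ := Submodule.mem_span_triple.mp this
  refine ⟨d, x', y', z', a, b, c, hd0, hx, hy, hz, ?_⟩
  apply mul_left_cancel₀ hd0
  simp only [smul_eq_mul] at habc
  calc _ = a * (d * x') + b * (d * y') + c * (d * z') := by ring
    _ = _ := by rw [← hx, ← hy, ← hz, habc, mul_one]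

/-- Primitive integer points of the conic `Y² = XZ`. -/
lemma exists_param_of_sq_eq_mul {x y z a b c : ℤ} (hbez : a * x + b * y + c * z = 1)
    (h : y ^ 2 = x * z) :
    ∃ ε r t : ℤ, (ε = 1 ∨ ε = -1) ∧ x = ε * t ^ 2 ∧ y = ε * (r * t) ∧ z = ε * r ^ 2 := by
  have hxz : IsCoprime x z := by
    refine ⟨a ^ 2 * x + 2 * a * b * y + b ^ 2 * z + 2 * a * c * z, c ^ 2 * z + 2 * b * c * y, ?_⟩
    linear_combination (a * x + b * y + c * z + 1) * hbez - b ^ 2 * h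
  obtain ⟨t, ht⟩ := Int.sq_of_gcd_eq_one (Int.isCoprime_iff_gcd_eq_one.mp hxz) h.symm
  obtain ⟨r, hr⟩ := Int.sq_of_gcd_eq_one (Int.isCoprime_iff_gcd_eq_one.mp hxz.symm)
    (show z * x = y ^ 2 by rw [h, mul_comm])
  have mixed : y ^ 2 = -(t * r) ^ 2 → y = 0 ∧ (t = 0 ∨ r = 0) := fun hy => by
    have h1 : (t * r) ^ 2 = 0 := by nlinarith [sq_nonneg y, sq_nonneg (t * r)]
    exact ⟨pow_eq_zero_iff two_ne_zero |>.mp (by rw [hy, h1, neg_zero]),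
      mul_eq_zero.mp (pow_eq_zero_iff two_ne_zero |>.mp h1)⟩
  rcases ht with ht | ht <;> rcases hr with hr | hr
  · rcases sq_eq_sq_iff_eq_or_eq_neg.mp (show y ^ 2 = (r * t) ^ 2 by rw [h, ht, hr]; ring)
      with hy | hy
    · exact ⟨1, r, t, Or.inl rfl, by linarith, by linarith, by linarith⟩
    · exact ⟨1, -r, t, Or.inl rfl, by linarith, by linarith, by linarith⟩
  · obtain ⟨hy, rfl | rfl⟩ := mixed (by rw [h, ht, hr]; ring)
    · exact ⟨-1, r, 0, Or.inr rfl, by linarith, by linarith, by linarith⟩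
    · exact ⟨1, 0, t, Or.inl rfl, by linarith, by linarith, by linarith⟩
  · obtain ⟨hy, rfl | rfl⟩ := mixed (by rw [h, ht, hr]; ring)
    · exact ⟨1, r, 0, Or.inl rfl, by linarith, by linarith, by linarith⟩
    · exact ⟨-1, 0, t, Or.inr rfl, by linarith, by linarith, by linarith⟩
  · rcases sq_eq_sq_iff_eq_or_eq_neg.mp (show y ^ 2 = (r * t) ^ 2 by rw [h, ht, hr]; ring)
      with hy | hy
    · exact ⟨-1, -r, t, Or.inr rfl, by linarith, by linarith, by linarith⟩
    · exact ⟨-1, r, t, Or.inr rfl, by linarith, by linarith, by linarith⟩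

lemma card_le_of_injOn_abs_le {X : Type*} (S : Finset X) (κ : X → ℤ) (hκ : Set.InjOn κ S) (M : ℕ)
    (hM : ∀ x ∈ S, |κ x| ≤ M) : S.card ≤ 2 * M + 1 := by
  rw [← card_Icc_neg_self]
  exact Finset.card_le_card_of_injOn κ
    (fun x hx => Finset.mem_coe.mpr (Finset.mem_Icc.mpr (abs_le.mp (hM x hx)))) hκ

lemma mul_mul_sq_le_of_mul_abs_le {N h e K : ℤ} (h0 : 0 < h) (hN : h ≤ N) (H : N * |e| ≤ K) :
    h * (N * e ^ 2) ≤ K ^ 2 := by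
  have hN0 : 0 ≤ N := h0.le.trans hN
  calc h * (N * e ^ 2) ≤ N * (N * e ^ 2) := by gcongr
    _ = (N * |e|) ^ 2 := by rw [mul_pow, sq_abs]; ring
    _ ≤ K ^ 2 := by gcongr

lemma exists_ratio_of_collinear {p h : ℕ} (hp : p.Prime) (hh : 0 < h) (s : ℤ)
    (S : Finset (ℤ × ℤ × ℤ))
    (hS : ∀ x ∈ S, |x.1| ≤ 3 * (h : ℤ) ∧ |x.2.1| ≤ 3 * (h : ℤ) ^ 2 ∧ |x.2.2| ≤ (h : ℤ) ^ 3 ∧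
      (p : ℤ) ∣ x.1 * s ^ 2 + x.2.1 * s + x.2.2)
    (hN1 : 6000 * h ≤ S.card) (hN3 : 6000 * h ^ 6 ≤ S.card * p)
    (hcross : ∀ x ∈ S, ∀ y ∈ S, x.2.1 * y.2.2 - x.2.2 * y.2.1 = 0 ∧
      x.2.2 * y.1 - x.1 * y.2.2 = 0 ∧ x.1 * y.2.1 - x.2.1 * y.1 = 0) :
    ∃ r t : ℤ, r ≠ 0 ∧ S.card * r ^ 2 ≤ 361 * (h : ℤ) ^ 3 ∧ S.card * t ^ 2 ≤ 361 * (h : ℤ) ^ 5 ∧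
      (p : ℤ) ∣ r * s - t := by
  obtain ⟨x₀, hx₀, hne⟩ : ∃ x ∈ S, x ≠ 0 := Finset.exists_mem_ne (by omega) 0
  obtain ⟨g, e1, e2, e3, a, b, c, hg, h1, h2, h3, hbez⟩ :=
    exists_primitive_triple x₀.1 x₀.2.1 x₀.2.2
    (fun H => hne (Prod.ext H.1 (Prod.ext H.2.1 H.2.2)))
  let κ : ℤ × ℤ × ℤ → ℤ := fun x => a * x.1 + b * x.2.1 + c * x.2.2
  have hκ : ∀ x ∈ S, x.1 = κ x * e1 ∧ x.2.1 = κ x * e2 ∧ x.2.2 = κ x * e3 := fun x hx => by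
    obtain ⟨c1, c2, c3⟩ := hcross x₀ hx₀ x hx
    simp only [h1, h2, h3] at c1 c2 c3
    have c1' : e2 * x.2.2 - e3 * x.2.1 = 0 := by
      apply mul_left_cancel₀ hg; linear_combination c1
    have c2' : e3 * x.1 - e1 * x.2.2 = 0 := by
      apply mul_left_cancel₀ hg; linear_combination c2
    have c3' : e1 * x.2.1 - e2 * x.1 = 0 := by
      apply mul_left_cancel₀ hg; linear_combination c3
    refine ⟨?_, ?_, ?_⟩ <;> dsimp only [κ]
    · linear_combination -x.1 * hbez + c * c2' - b * c3'
    · linear_combination -x.2.1 * hbez + a * c3' - c * c1'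
    · linear_combination -x.2.2 * hbez + b * c1' - a * c2'
  have hinj : Set.InjOn κ S := fun x hx y hy hxy => by
    obtain ⟨u1, u2, u3⟩ := hκ x hx
    obtain ⟨v1, v2, v3⟩ := hκ y hy
    exact Prod.ext (by rw [u1, v1, hxy]) (Prod.ext (by rw [u2, v2, hxy]) (by rw [u3, v3, hxy]))
  have hhpos : (0 : ℤ) < h := by exact_mod_cast hh
  have hN1' : 6000 * (h : ℤ) ≤ S.card := by exact_mod_cast hN1
  obtain ⟨y, hy, hyN⟩ : ∃ y ∈ S, (S.card : ℤ) ≤ 3 * |κ y| := by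
    by_contra! H
    have := card_le_of_injOn_abs_le S κ hinj ((S.card - 2) / 2) (fun x hx => by
      have := H x hx; omega)
    omega
  obtain ⟨k1, k2, k3⟩ := hκ y hy
  obtain ⟨b1, b2, b3, -⟩ := hS y hy
  rw [k1, abs_mul] at b1
  rw [k2, abs_mul] at b2
  rw [k3, abs_mul] at b3
  have B1 : S.card * |e1| ≤ 9 * (h : ℤ) := by
    linarith [mul_le_mul_of_nonneg_right hyN (abs_nonneg e1)]
  have B2 : S.card * |e2| ≤ 9 * (h : ℤ) ^ 2 := by
    linarith [mul_le_mul_of_nonneg_right hyN (abs_nonneg e2)]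
  have B3 : S.card * |e3| ≤ 3 * (h : ℤ) ^ 3 := by
    linarith [mul_le_mul_of_nonneg_right hyN (abs_nonneg e3)]
  have he1 : e1 = 0 := by
    by_contra H
    linarith [le_mul_of_one_le_right (Nat.cast_nonneg (α := ℤ) S.card) (Int.one_le_abs H)]
  obtain ⟨z, hz, hzp⟩ : ∃ z ∈ S, ¬ (p : ℤ) ∣ κ z := by
    by_contra! H
    have hpp := hp.pos
    have hp0 : (p : ℤ) ≠ 0 := by exact_mod_cast hp.ne_zero
    have hb : ∀ x ∈ S, |κ x| ≤ 3 * (h : ℤ) ^ 3 := fun x hx => by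
      obtain ⟨k1, k2, k3⟩ := hκ x hx
      obtain ⟨-, b2, b3, -⟩ := hS x hx
      have hhh : (h : ℤ) ^ 2 ≤ h ^ 3 := pow_le_pow_right₀ (by omega) (by norm_num)
      by_cases h2 : e2 = 0
      · have h3 : e3 ≠ 0 := by rintro rfl; simp [he1, h2] at hbez
        rw [k3, abs_mul] at b3
        linarith [le_mul_of_one_le_right (abs_nonneg (κ x)) (Int.one_le_abs h3),
          pow_nonneg hhpos.le 3]
      · rw [k2, abs_mul] at b2
        linarith [le_mul_of_one_le_right (abs_nonneg (κ x)) (Int.one_le_abs h2)]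
    have := card_le_of_injOn_abs_le S (fun x => κ x / p)
      (fun x hx y hy hxy => hinj hx hy ((Int.ediv_left_inj (H x hx) (H y hy)).mp hxy))
      (3 * h ^ 3 / p) (fun x hx => by
        obtain ⟨k, hk⟩ := H x hx
        have hbx := hb x hx
        simp only [hk, Int.mul_ediv_cancel_left _ hp0]
        push_cast
        rw [Int.le_ediv_iff_mul_le (by exact_mod_cast hpp)]
        rw [hk, abs_mul, abs_of_pos (by exact_mod_cast hpp : (0 : ℤ) < p)] at hbx
        linarith)
    have hq := Nat.div_mul_le_self (3 * h ^ 3) p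
    have h6 : h ^ 3 ≤ h ^ 6 := Nat.pow_le_pow_right hh (by norm_num)
    have h7 : S.card * p ≤ 2 * (3 * h ^ 3) + p := by nlinarith
    have h8 : 6000 * p ≤ S.card * p := Nat.mul_le_mul_right _ (by omega)
    have : 0 < h ^ 6 := by positivity
    omega
  have hpe : (p : ℤ) ∣ e2 * s + e3 := by
    obtain ⟨k1, k2, k3⟩ := hκ z hz
    have hd := (hS z hz).2.2.2
    rw [k1, k2, k3, he1, show κ z * 0 * s ^ 2 + κ z * e2 * s + κ z * e3 = κ z * (e2 * s + e3) by
      ring] at hd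
    exact ((Nat.prime_iff_prime_int.mp hp).dvd_mul.mp hd).resolve_left hzp
  have he2 : e2 ≠ 0 := by
    rintro rfl
    rw [zero_mul, zero_add] at hpe
    apply (Nat.prime_iff_prime_int.mp hp).not_dvd_one
    rw [← hbez, he1]
    simpa using hpe.mul_left c
  refine ⟨e2, -e3, he2, ?_, ?_, by simpa using hpe⟩
  · refine le_of_mul_le_mul_left ?_ hhpos
    calc _ ≤ (9 * (h : ℤ) ^ 2) ^ 2 := mul_mul_sq_le_of_mul_abs_le hhpos (by linarith) B2
      _ ≤ _ := by linarith [pow_nonneg hhpos.le 4]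
  · refine le_of_mul_le_mul_left ?_ hhpos
    calc _ ≤ (3 * (h : ℤ) ^ 3) ^ 2 :=
          mul_mul_sq_le_of_mul_abs_le hhpos (by linarith) (by rwa [abs_neg])
      _ ≤ _ := by linarith [pow_nonneg hhpos.le 6]

/-- The three coordinate projections of a planar set, with the corresponding box sizes. -/
lemma card_mul_le_of_coplanar (h : ℕ) (hh : 0 < h) (S : Finset (ℤ × ℤ × ℤ))
    (hS : ∀ x ∈ S, |x.1| ≤ 3 * (h : ℤ) ∧ |x.2.1| ≤ 3 * (h : ℤ) ^ 2 ∧ |x.2.2| ≤ (h : ℤ) ^ 3)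
    {n1 n2 n3 a b c g : ℤ} (hbez : a * n1 + b * n2 + c * n3 = 1) (hg : g ≠ 0)
    (hn : ∀ x ∈ S, n1 * x.1 + n2 * x.2.1 + n3 * x.2.2 = 0)
    {u v : ℤ × ℤ × ℤ} (hu : u ∈ S) (hv : v ∈ S)
    (h1 : u.2.1 * v.2.2 - u.2.2 * v.2.1 = g * n1) (h2 : u.2.2 * v.1 - u.1 * v.2.2 = g * n2)
    (h3 : u.1 * v.2.1 - u.2.1 * v.1 = g * n3) :
    S.card * |n1| ≤ 361 * (h : ℤ) ^ 5 ∧ S.card * |n2| ≤ 361 * (h : ℤ) ^ 4 ∧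
      S.card * |n3| ≤ 361 * (h : ℤ) ^ 3 ∧
      ∀ p : ℕ, p.Prime → (∀ x ∈ S, ∀ y ∈ S, (p : ℤ) ∣ x.2.1 * y.2.2 - x.2.2 * y.2.1 ∧
        (p : ℤ) ∣ x.2.2 * y.1 - x.1 * y.2.2 ∧ (p : ℤ) ∣ x.1 * y.2.1 - x.2.1 * y.1) →
        S.card * p ≤ 361 * h ^ 5 := by
  have box1 : (6 * (3 * h ^ 2) + 1) * (6 * h ^ 3 + 1) ≤ 361 * h ^ 5 := by
    have i2 : 1 ≤ h ^ 2 := Nat.one_le_pow _ _ hh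
    have i3 : 1 ≤ h ^ 3 := Nat.one_le_pow _ _ hh
    calc _ ≤ (19 * h ^ 2) * (19 * h ^ 3) := Nat.mul_le_mul (by omega) (by omega)
      _ = _ := by ring
  have box2 : (6 * (3 * h) + 1) * (6 * h ^ 3 + 1) ≤ 361 * h ^ 4 := by
    have i3 : 1 ≤ h ^ 3 := Nat.one_le_pow _ _ hh
    calc _ ≤ (19 * h) * (19 * h ^ 3) := Nat.mul_le_mul (by omega) (by omega)
      _ = _ := by ring
  have box3 : (6 * (3 * h) + 1) * (6 * (3 * h ^ 2) + 1) ≤ 361 * h ^ 3 := by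
    have i2 : 1 ≤ h ^ 2 := Nat.one_le_pow _ _ hh
    calc _ ≤ (19 * h) * (19 * h ^ 2) := Nat.mul_le_mul (by omega) (by omega)
      _ = _ := by ring
  have inj1 : n1 ≠ 0 → Set.InjOn (fun x : ℤ × ℤ × ℤ => (x.2.1, x.2.2)) S := by
    rintro h0 ⟨x1, x2, x3⟩ hx ⟨y1, y2, y3⟩ hy hxy
    simp only [Prod.mk.injEq] at hxy ⊢
    have := hn _ hx
    have := hn _ hy
    obtain ⟨rfl, rfl⟩ := hxy
    exact ⟨mul_left_cancel₀ h0 (by simp only at *; linarith), rfl, rfl⟩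
  have inj2 : n2 ≠ 0 → Set.InjOn (fun x : ℤ × ℤ × ℤ => (x.1, x.2.2)) S := by
    rintro h0 ⟨x1, x2, x3⟩ hx ⟨y1, y2, y3⟩ hy hxy
    simp only [Prod.mk.injEq] at hxy ⊢
    have := hn _ hx
    have := hn _ hy
    obtain ⟨rfl, rfl⟩ := hxy
    exact ⟨rfl, mul_left_cancel₀ h0 (by simp only at *; linarith), rfl⟩
  have inj3 : n3 ≠ 0 → Set.InjOn (fun x : ℤ × ℤ × ℤ => (x.1, x.2.1)) S := by
    rintro h0 ⟨x1, x2, x3⟩ hx ⟨y1, y2, y3⟩ hy hxy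
    simp only [Prod.mk.injEq] at hxy ⊢
    have := hn _ hx
    have := hn _ hy
    obtain ⟨rfl, rfl⟩ := hxy
    exact ⟨rfl, rfl, mul_left_cancel₀ h0 (by simp only at *; linarith)⟩
  refine ⟨?_, ?_, ?_, ?_⟩
  · by_cases h0 : n1 = 0
    · simp only [h0, abs_zero, mul_zero]; positivity
    have := card_mul_le_of_plane_lattice n1.natAbs (3 * h ^ 2) (h ^ 3) n2 n3 b c
      (by rw [Int.natAbs_dvd]; exact ⟨-a, by linear_combination hbez⟩)
      (S.image fun x => (x.2.1, x.2.2))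
      (by
        simp only [Finset.forall_mem_image]
        intro x hx
        obtain ⟨-, b2, b3⟩ := hS x hx
        refine ⟨by exact_mod_cast b2, by exact_mod_cast b3, ?_⟩
        rw [Int.natAbs_dvd]
        exact ⟨-x.1, by linear_combination hn x hx⟩)
      (Finset.mem_image_of_mem _ hu) (Finset.mem_image_of_mem _ hv)
      (by simpa only [h1] using mul_ne_zero hg h0)
    rw [Finset.card_image_of_injOn (inj1 h0)] at this
    rw [Int.abs_eq_natAbs]
    exact_mod_cast this.trans box1
  · by_cases h0 : n2 = 0
    · simp only [h0, abs_zero, mul_zero]; positivity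
    have := card_mul_le_of_plane_lattice n2.natAbs (3 * h) (h ^ 3) n1 n3 a c
      (by rw [Int.natAbs_dvd]; exact ⟨-b, by linear_combination hbez⟩)
      (S.image fun x => (x.1, x.2.2))
      (by
        simp only [Finset.forall_mem_image]
        intro x hx
        obtain ⟨b1, -, b3⟩ := hS x hx
        refine ⟨by exact_mod_cast b1, by exact_mod_cast b3, ?_⟩
        rw [Int.natAbs_dvd]
        exact ⟨-x.2.1, by linear_combination hn x hx⟩)
      (Finset.mem_image_of_mem _ hu) (Finset.mem_image_of_mem _ hv)
      (by
        intro H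
        exact mul_ne_zero hg h0 (by simp only at H; linarith))
    rw [Finset.card_image_of_injOn (inj2 h0)] at this
    rw [Int.abs_eq_natAbs]
    exact_mod_cast this.trans box2
  · by_cases h0 : n3 = 0
    · simp only [h0, abs_zero, mul_zero]; positivity
    have := card_mul_le_of_plane_lattice n3.natAbs (3 * h) (3 * h ^ 2) n1 n2 a b
      (by rw [Int.natAbs_dvd]; exact ⟨-c, by linear_combination hbez⟩)
      (S.image fun x => (x.1, x.2.1))
      (by
        simp only [Finset.forall_mem_image]
        intro x hx
        obtain ⟨b1, b2, -⟩ := hS x hx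
        refine ⟨by exact_mod_cast b1, by exact_mod_cast b2, ?_⟩
        rw [Int.natAbs_dvd]
        exact ⟨-x.2.2, by linear_combination hn x hx⟩)
      (Finset.mem_image_of_mem _ hu) (Finset.mem_image_of_mem _ hv)
      (by simpa only [h3] using mul_ne_zero hg h0)
    rw [Finset.card_image_of_injOn (inj3 h0)] at this
    rw [Int.abs_eq_natAbs]
    exact_mod_cast this.trans box3
  · intro p hp hdet
    have h45 : 361 * h ^ 4 ≤ 361 * h ^ 5 :=
      Nat.mul_le_mul_left _ (Nat.pow_le_pow_right hh (by norm_num))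
    have h35 : 361 * h ^ 3 ≤ 361 * h ^ 5 :=
      Nat.mul_le_mul_left _ (Nat.pow_le_pow_right hh (by norm_num))
    by_cases h01 : n1 = 0
    · by_cases h02 : n2 = 0
      · have h03 : n3 ≠ 0 := by rintro rfl; simp [h01, h02] at hbez
        have := card_mul_le_of_prime_dvd_det hp (3 * h) (3 * h ^ 2)
          (S.image fun x => (x.1, x.2.1))
          (by
            simp only [Finset.forall_mem_image]
            intro x hx
            obtain ⟨b1, b2, -⟩ := hS x hx
            exact ⟨by exact_mod_cast b1, by exact_mod_cast b2⟩)
          (by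
            simp only [Finset.forall_mem_image]
            exact fun x hx y hy => (hdet x hx y hy).2.2)
          (Finset.mem_image_of_mem _ hu) (Finset.mem_image_of_mem _ hv)
          (by simpa only [h3] using mul_ne_zero hg h03)
        rw [Finset.card_image_of_injOn (inj3 h03)] at this
        exact (this.trans box3).trans h35
      · have := card_mul_le_of_prime_dvd_det hp (3 * h) (h ^ 3)
          (S.image fun x => (x.1, x.2.2))
          (by
            simp only [Finset.forall_mem_image]
            intro x hx
            obtain ⟨b1, -, b3⟩ := hS x hx
            exact ⟨by exact_mod_cast b1, by exact_mod_cast b3⟩)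
          (by
            simp only [Finset.forall_mem_image]
            intro x hx y hy
            rw [← dvd_neg, neg_sub]
            exact (hdet x hx y hy).2.1)
          (Finset.mem_image_of_mem _ hu) (Finset.mem_image_of_mem _ hv)
          (by
            intro H
            exact mul_ne_zero hg h02 (by simp only at H; linarith))
        rw [Finset.card_image_of_injOn (inj2 h02)] at this
        exact (this.trans box2).trans h45
    · have := card_mul_le_of_prime_dvd_det hp (3 * h ^ 2) (h ^ 3)
        (S.image fun x => (x.2.1, x.2.2))
        (by
          simp only [Finset.forall_mem_image]
          intro x hx
          obtain ⟨-, b2, b3⟩ := hS x hx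
          exact ⟨by exact_mod_cast b2, by exact_mod_cast b3⟩)
        (by
          simp only [Finset.forall_mem_image]
          exact fun x hx y hy => (hdet x hx y hy).1)
        (Finset.mem_image_of_mem _ hu) (Finset.mem_image_of_mem _ hv)
        (by simpa only [h1] using mul_ne_zero hg h01)
      rw [Finset.card_image_of_injOn (inj1 h01)] at this
      exact this.trans box1

/-- The primitive normal `n` of the plane spanned by `u` and `v`, where `u × v = g n`. -/
lemma exists_primitive_normal (S : Finset (ℤ × ℤ × ℤ))
    (hdet : ∀ u ∈ S, ∀ v ∈ S, ∀ w ∈ S, (u.2.1 * v.2.2 - u.2.2 * v.2.1) * w.1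
      + (u.2.2 * v.1 - u.1 * v.2.2) * w.2.1 + (u.1 * v.2.1 - u.2.1 * v.1) * w.2.2 = 0)
    {u v : ℤ × ℤ × ℤ} (hu : u ∈ S) (hv : v ∈ S)
    (hne : ¬ (u.2.1 * v.2.2 - u.2.2 * v.2.1 = 0 ∧ u.2.2 * v.1 - u.1 * v.2.2 = 0 ∧
      u.1 * v.2.1 - u.2.1 * v.1 = 0)) :
    ∃ g n1 n2 n3 a b c : ℤ, g ≠ 0 ∧ u.2.1 * v.2.2 - u.2.2 * v.2.1 = g * n1 ∧
      u.2.2 * v.1 - u.1 * v.2.2 = g * n2 ∧ u.1 * v.2.1 - u.2.1 * v.1 = g * n3 ∧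
      a * n1 + b * n2 + c * n3 = 1 ∧ ∀ x ∈ S, n1 * x.1 + n2 * x.2.1 + n3 * x.2.2 = 0 := by
  obtain ⟨g, n1, n2, n3, a, b, c, hg, h1, h2, h3, hbez⟩ := exists_primitive_triple _ _ _ hne
  refine ⟨g, n1, n2, n3, a, b, c, hg, h1, h2, h3, hbez, fun x hx => mul_left_cancel₀ hg ?_⟩
  have := hdet u hu v hv x hx
  rw [h1, h2, h3] at this
  linear_combination this

lemma exists_ratio_of_card_ge {p h : ℕ} (hp : p.Prime) (hh : 0 < h) (s : ℤ)
    (S : Finset (ℤ × ℤ × ℤ))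
    (hS : ∀ x ∈ S, |x.1| ≤ 3 * (h : ℤ) ∧ |x.2.1| ≤ 3 * (h : ℤ) ^ 2 ∧ |x.2.2| ≤ (h : ℤ) ^ 3 ∧
      (p : ℤ) ∣ x.1 * s ^ 2 + x.2.1 * s + x.2.2)
    (hN1 : 6000 * h ≤ S.card) (hN2 : (6000 * h ^ 4) ^ 2 ≤ S.card ^ 2 * p)
    (hN3 : 6000 * h ^ 6 ≤ S.card * p) :
    ∃ r t : ℤ, r ≠ 0 ∧ S.card * r ^ 2 ≤ 361 * (h : ℤ) ^ 3 ∧ S.card * t ^ 2 ≤ 361 * (h : ℤ) ^ 5 ∧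
      (p : ℤ) ∣ r * s - t := by
  have hpZ := Nat.prime_iff_prime_int.mp hp
  have hdet : ∀ u ∈ S, ∀ v ∈ S, ∀ w ∈ S, (u.2.1 * v.2.2 - u.2.2 * v.2.1) * w.1
      + (u.2.2 * v.1 - u.1 * v.2.2) * w.2.1 + (u.1 * v.2.1 - u.2.1 * v.1) * w.2.2 = 0 := by
    intro u hu v hv w hw
    by_contra H
    have h1 := card_mul_le_of_det_ne_zero p h s S hS hu hv hw H
    have i2 : 1 ≤ h ^ 2 := Nat.one_le_pow _ _ hh
    have i3 : 1 ≤ h ^ 3 := Nat.one_le_pow _ _ hh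
    have i6 : 1 ≤ h ^ 6 := Nat.one_le_pow _ _ hh
    have h2 : (24 * h + 1) * ((24 * h ^ 2 + 1) * (8 * h ^ 3 + 1)) ≤ 5625 * h ^ 6 := by
      calc _ ≤ (25 * h) * ((25 * h ^ 2) * (9 * h ^ 3)) :=
            Nat.mul_le_mul (by omega) (Nat.mul_le_mul (by omega) (by omega))
        _ = _ := by ring
    omega
  by_cases hmod : ∀ x ∈ S, ∀ y ∈ S, (p : ℤ) ∣ x.2.1 * y.2.2 - x.2.2 * y.2.1 ∧
        (p : ℤ) ∣ x.2.2 * y.1 - x.1 * y.2.2 ∧ (p : ℤ) ∣ x.1 * y.2.1 - x.2.1 * y.1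
  · refine exists_ratio_of_collinear hp hh s S hS hN1 hN3 fun u hu v hv => ?_
    by_contra hne
    obtain ⟨g, n1, n2, n3, a, b, c, hg, h1, h2, h3, hbez, hn⟩ :=
      exists_primitive_normal S hdet hu hv hne
    have h4 := (card_mul_le_of_coplanar h hh S
      (fun x hx => ⟨(hS x hx).1, (hS x hx).2.1, (hS x hx).2.2.1⟩) hbez hg hn hu hv
      h1 h2 h3).2.2.2 p hp hmod
    have i6 : 1 ≤ h ^ 6 := Nat.one_le_pow _ _ hh
    have h56 : h ^ 5 ≤ h ^ 6 := Nat.pow_le_pow_right hh (by norm_num)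
    omega
  · push Not at hmod
    obtain ⟨u, hu, v, hv, huv⟩ := hmod
    obtain ⟨g, n1, n2, n3, a, b, c, hg, h1, h2, h3, hbez, hn⟩ :=
      exists_primitive_normal S hdet hu hv (fun H => huv (by simp [H.1]) (by simp [H.2.1])
        (by simp [H.2.2]))
    have hpg : ¬ (p : ℤ) ∣ g := fun H =>
      huv (h1 ▸ H.mul_right _) (h2 ▸ H.mul_right _) (h3 ▸ H.mul_right _)
    obtain ⟨B1, B2, B3, -⟩ := card_mul_le_of_coplanar h hh S
      (fun x hx => ⟨(hS x hx).1, (hS x hx).2.1, (hS x hx).2.2.1⟩) hbez hg hn hu hv h1 h2 h3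
    have du := (hS u hu).2.2.2
    have dv := (hS v hv).2.2.2
    have d23 : (p : ℤ) ∣ n2 - s * n3 := by
      refine (hpZ.dvd_mul.mp ?_).resolve_left hpg
      rw [show g * (n2 - s * n3) = v.1 * (u.1 * s ^ 2 + u.2.1 * s + u.2.2)
        - u.1 * (v.1 * s ^ 2 + v.2.1 * s + v.2.2) by
          linear_combination s * h3 - h2]
      exact (du.mul_left _).sub (dv.mul_left _)
    have d12 : (p : ℤ) ∣ n1 - s * n2 := by
      rw [show n1 - s * n2 = (n1 - s ^ 2 * n3) - s * (n2 - s * n3) by ring]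
      refine dvd_sub ((hpZ.dvd_mul.mp ?_).resolve_left hpg) (d23.mul_left _)
      rw [show g * (n1 - s ^ 2 * n3) = u.2.1 * (v.1 * s ^ 2 + v.2.1 * s + v.2.2)
        - v.2.1 * (u.1 * s ^ 2 + u.2.1 * s + u.2.2) by
          linear_combination s ^ 2 * h3 - h1]
      exact (dv.mul_left _).sub (du.mul_left _)
    have hconic : n2 ^ 2 = n1 * n3 := by
      have hd : (p : ℤ) ∣ n2 ^ 2 - n1 * n3 := by
        rw [show n2 ^ 2 - n1 * n3 = n2 * (n2 - s * n3) - n3 * (n1 - s * n2) by ring]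
        exact (d23.mul_left _).sub (d12.mul_left _)
      rw [← sub_eq_zero]
      refine Int.eq_zero_of_abs_lt_dvd hd ?_
      have hN2' : (6000 * (h : ℤ) ^ 4) ^ 2 ≤ (S.card : ℤ) ^ 2 * p := by exact_mod_cast hN2
      have q2 : (S.card * |n2|) * (S.card * |n2|) ≤ 361 * (h : ℤ) ^ 4 * (361 * (h : ℤ) ^ 4) :=
        mul_le_mul B2 B2 (by positivity) (by positivity)
      have q13 : (S.card * |n1|) * (S.card * |n3|) ≤ 361 * (h : ℤ) ^ 5 * (361 * (h : ℤ) ^ 3) :=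
        mul_le_mul B1 B3 (by positivity) (by positivity)
      have htri : |n2 ^ 2 - n1 * n3| ≤ |n2| * |n2| + |n1| * |n3| := by
        rw [← abs_mul, ← abs_mul, ← sq]; exact abs_sub _ _
      have hc : (0 : ℤ) ≤ (S.card : ℤ) ^ 2 := by positivity
      have h8 : (0 : ℤ) < (h : ℤ) ^ 8 := by positivity
      refine lt_of_mul_lt_mul_left ?_ hc
      calc (S.card : ℤ) ^ 2 * |n2 ^ 2 - n1 * n3|
          ≤ (S.card : ℤ) ^ 2 * (|n2| * |n2| + |n1| * |n3|) := mul_le_mul_of_nonneg_left htri hc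
        _ < (S.card : ℤ) ^ 2 * p := by nlinarith
    obtain ⟨ε, r, t, hε, rfl, rfl, rfl⟩ := exists_param_of_sq_eq_mul hbez hconic
    have hε2 : ε * ε = 1 := by rcases hε with rfl | rfl <;> norm_num
    have hεa : |ε| = 1 := by rcases hε with rfl | rfl <;> norm_num
    have hrt : (p : ℤ) ∣ r * s - t := by
      rw [show r * s - t = -((a * t + b * r) * (ε * t ^ 2 - s * (ε * (r * t)))
        + c * r * (ε * (r * t) - s * (ε * r ^ 2))) by
          linear_combination (t - r * s) * hbez]
      exact ((d12.mul_left _).add (d23.mul_left _)).neg_right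
    refine ⟨r, t, ?_, ?_, ?_, hrt⟩
    · rintro rfl
      rw [zero_mul, zero_sub, dvd_neg] at hrt
      apply hpZ.not_dvd_one
      rw [← hbez, show a * (ε * t ^ 2) + b * (ε * (0 * t)) + c * (ε * 0 ^ 2) = a * ε * t * t by
        ring]
      exact hrt.mul_left _
    · simpa [abs_mul, hεa] using B3
    · simpa [abs_mul, hεa] using B1

lemma abs_le_of_mul_sq_le {T x H : ℝ} (e : ℝ) (hT : 0 < T) (hH : 0 < H)
    (hx : T * x ^ 2 ≤ 361 * H ^ (2 * e)) :
    |x| ≤ 19 * H ^ e * T ^ (-(1 / 2) : ℝ) := by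
  have hTT : (T ^ (-(1 / 2) : ℝ)) ^ 2 * T = 1 := by
    rw [← Real.rpow_natCast, ← Real.rpow_mul hT.le]
    norm_num [Real.rpow_neg_one, inv_mul_cancel₀ hT.ne']
  apply abs_le_of_sq_le_sq _ (by positivity)
  refine le_of_mul_le_mul_left ?_ hT
  have hHH : H ^ (2 * e) = (H ^ e) ^ 2 := by
    rw [← Real.rpow_natCast, ← Real.rpow_mul hH.le, mul_comm]; norm_num
  calc _ ≤ 361 * H ^ (2 * e) := hx
    _ = 361 * (H ^ e) ^ 2 * ((T ^ (-(1 / 2) : ℝ)) ^ 2 * T) := by rw [hTT, hHH, mul_one]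
    _ = _ := by ring


/-- There are absolute `C₀, C₁ > 0` such that for every prime `p`, positive
integer `h`, integer `s`, and integer `T ≥ C₀·max{h, h⁴p^{−1/2}, h⁶p^{−1}}`: if there are at
least `T` distinct triples `(U,V,W)` with `|U| ≤ 3h`, `|V| ≤ 3h²`, `|W| ≤ h³` and
`Us² + Vs + W ≡ 0 (mod p)`, then there are integers `r, t` with `0 < |r| ≤ C₁·h^{3/2}·T^{−1/2}`,
`|t| ≤ C₁·h^{5/2}·T^{−1/2}` and `rs ≡ t (mod p)`. -/
theorem stmt17 :
    ∃ C₀ C₁ : ℝ, 0 < C₀ ∧ 0 < C₁ ∧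
      ∀ p : ℕ, p.Prime → ∀ h : ℕ, 0 < h → ∀ s : ℤ, ∀ T : ℤ,
        (T : ℝ) ≥ C₀ * max (h : ℝ) (max ((h : ℝ) ^ 4 * (p : ℝ) ^ (-(1 / 2) : ℝ))
          ((h : ℝ) ^ 6 * (p : ℝ)⁻¹)) →
        T ≤ (Set.ncard {uvw : ℤ × ℤ × ℤ |
            |uvw.1| ≤ 3 * (h : ℤ) ∧ |uvw.2.1| ≤ 3 * (h : ℤ) ^ 2 ∧ |uvw.2.2| ≤ (h : ℤ) ^ 3 ∧
            ((p : ℤ) ∣ (uvw.1 * s ^ 2 + uvw.2.1 * s + uvw.2.2))} : ℤ) →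
        ∃ r t : ℤ, 0 < |r| ∧
          (|r| : ℝ) ≤ C₁ * (h : ℝ) ^ ((3 : ℝ) / 2) * (T : ℝ) ^ (-(1 / 2) : ℝ) ∧
          (|t| : ℝ) ≤ C₁ * (h : ℝ) ^ ((5 : ℝ) / 2) * (T : ℝ) ^ (-(1 / 2) : ℝ) ∧
          (p : ℤ) ∣ (r * s - t) := by
  refine ⟨6000, 19, by norm_num, by norm_num, ?_⟩
  intro p hp h hh s T hT hcard
  set A : Set (ℤ × ℤ × ℤ) := {uvw : ℤ × ℤ × ℤ |
    |uvw.1| ≤ 3 * (h : ℤ) ∧ |uvw.2.1| ≤ 3 * (h : ℤ) ^ 2 ∧ |uvw.2.2| ≤ (h : ℤ) ^ 3 ∧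
    ((p : ℤ) ∣ (uvw.1 * s ^ 2 + uvw.2.1 * s + uvw.2.2))} with hA
  have hhR : (0 : ℝ) < h := by exact_mod_cast hh
  have hpR : (0 : ℝ) < p := by exact_mod_cast hp.pos
  have t1 : 6000 * (h : ℝ) ≤ T :=
    (mul_le_mul_of_nonneg_left (le_max_left _ _) (by norm_num)).trans hT
  have t2 : 6000 * ((h : ℝ) ^ 4 * (p : ℝ) ^ (-(1 / 2) : ℝ)) ≤ T :=
    (mul_le_mul_of_nonneg_left ((le_max_left _ _).trans (le_max_right _ _))
      (by norm_num)).trans hT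
  have t3 : 6000 * ((h : ℝ) ^ 6 * (p : ℝ)⁻¹) ≤ T :=
    (mul_le_mul_of_nonneg_left ((le_max_right _ _).trans (le_max_right _ _))
      (by norm_num)).trans hT
  have hTpos : (0 : ℝ) < T := by linarith
  have hTZ : 0 < T := by exact_mod_cast hTpos
  have hfin : A.Finite := Set.finite_of_ncard_pos (by omega)
  have hTN : (T : ℝ) ≤ hfin.toFinset.card := by
    rw [Set.ncard_eq_toFinset_card A hfin] at hcard
    exact_mod_cast hcard
  have hpp : ((p : ℝ) ^ (-(1 / 2) : ℝ)) ^ 2 * p = 1 := by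
    rw [← Real.rpow_natCast, ← Real.rpow_mul hpR.le]
    norm_num [Real.rpow_neg_one, inv_mul_cancel₀ hpR.ne']
  obtain ⟨r, t, hr, hr2, ht2, hrt⟩ := exists_ratio_of_card_ge hp hh s hfin.toFinset
    (fun x hx => by simpa [hA] using hx)
    (by exact_mod_cast t1.trans hTN)
    (by
      have : (6000 * (h : ℝ) ^ 4) ^ 2 ≤ (hfin.toFinset.card : ℝ) ^ 2 * p := by
        calc (6000 * (h : ℝ) ^ 4) ^ 2
            = (6000 * ((h : ℝ) ^ 4 * (p : ℝ) ^ (-(1 / 2) : ℝ))) ^ 2 * p := by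
              linear_combination -(6000 * (h : ℝ) ^ 4) ^ 2 * hpp
          _ ≤ _ := by gcongr; exact t2.trans hTN
      exact_mod_cast this)
    (by
      have : 6000 * (h : ℝ) ^ 6 ≤ hfin.toFinset.card * p := by
        calc 6000 * (h : ℝ) ^ 6 = 6000 * ((h : ℝ) ^ 6 * (p : ℝ)⁻¹) * p := by field_simp
          _ ≤ _ := by gcongr; exact t3.trans hTN
      exact_mod_cast this)
  have hr2' : (hfin.toFinset.card : ℝ) * (r : ℝ) ^ 2 ≤ 361 * (h : ℝ) ^ 3 := by exact_mod_cast hr2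
  have ht2' : (hfin.toFinset.card : ℝ) * (t : ℝ) ^ 2 ≤ 361 * (h : ℝ) ^ 5 := by exact_mod_cast ht2
  refine ⟨r, t, abs_pos.mpr hr, ?_, ?_, hrt⟩
  · refine abs_le_of_mul_sq_le _ hTpos hhR ?_
    rw [show (2 * (3 / 2) : ℝ) = (3 : ℕ) by norm_num, Real.rpow_natCast]
    exact (mul_le_mul_of_nonneg_right hTN (sq_nonneg _)).trans hr2'
  · refine abs_le_of_mul_sq_le _ hTpos hhR ?_
    rw [show (2 * (5 / 2) : ℝ) = (5 : ℕ) by norm_num, Real.rpow_natCast]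
    exact (mul_le_mul_of_nonneg_right hTN (sq_nonneg _)).trans ht2'
end

section
/- Fix an integer ν ≥ 1. There exists a constant C = C(ν) > 0 such that for every integer h ≥ 3 and all integers r ≥ 1 and t with gcd(r,t) = 1, setting σ = t/r, the number N of tuples of integers (x_1,…,x_ν,y_1,…,y_ν) with 1 ≤ x_i, y_i ≤ h satisfying (x_1+σ)⋯(x_ν+σ) = (y_1+σ)⋯(y_ν+σ) ≠ 0 and {x_1,…,x_ν} ∩ {y_1,…,y_ν} = ∅ satisfies N ≤ (h^{ν+1}/max{h·r, |t|})·exp(C·log h/log log h). -/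
theorem exists_forall_dvd_prod_eq_of_dvd_prod {ι M : Type*} [CommMonoid M] [DecompositionMonoid M]
    [Subsingleton Mˣ] (s : Finset ι) (b : ι → M) :
    ∀ a : M, a ∣ ∏ i ∈ s, b i → ∃ d : ι → M, (∀ i ∈ s, d i ∣ b i) ∧ ∏ i ∈ s, d i = a := by
  classical
  induction s using Finset.induction_on with
  | empty =>
    intro a ha
    rw [Finset.prod_empty] at ha
    exact ⟨fun _ => a, by simp, by simpa using (isUnit_iff_eq_one.1 (isUnit_of_dvd_one ha)).symm⟩
  | insert j s hj ih =>
    intro a ha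
    rw [Finset.prod_insert hj] at ha
    obtain ⟨u, v, hu, hv, rfl⟩ := exists_dvd_and_dvd_of_dvd_mul ha
    obtain ⟨d, hd, rfl⟩ := ih v hv
    refine ⟨Function.update d j u, ?_, ?_⟩
    · intro i hi
      rcases Finset.mem_insert.1 hi with rfl | hi
      · simpa using hu
      · rw [Function.update_of_ne (ne_of_mem_of_not_mem hi hj)]
        exact hd i hi
    · rw [Finset.prod_insert hj, Function.update_self]
      congr 1
      refine Finset.prod_congr rfl fun i hi => ?_
      rw [Function.update_of_ne (ne_of_mem_of_not_mem hi hj)]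

theorem Int.natAbs_finset_prod {ι : Type*} (s : Finset ι) (f : ι → ℤ) :
    (∏ i ∈ s, f i).natAbs = ∏ i ∈ s, (f i).natAbs :=
  map_prod Int.natAbsHom f s

theorem card_filter_dvd_sub_mul_le {h d : ℕ} (hd : 0 < d) (hdh : d ≤ h) (v : ℤ) :
    ((Finset.Icc (1 : ℤ) h).filter fun y => (d : ℤ) ∣ y - v).card * d ≤ 2 * h := by
  have hset : ((Finset.Icc (1 : ℤ) h).filter fun y => (d : ℤ) ∣ y - v) =
      (Finset.Ioc (0 : ℤ) h).filter fun y => y ≡ v [ZMOD d] := by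
    ext y
    simp only [Finset.mem_filter, Finset.mem_Icc, Finset.mem_Ioc]
    rw [Int.modEq_comm, Int.modEq_iff_dvd]
    rfl
  have hc := Int.Ioc_filter_modEq_card (0 : ℤ) (h : ℤ) (r := d) (by exact_mod_cast hd) v
  rw [← hset] at hc
  set c := ((Finset.Icc (1 : ℤ) h).filter fun y => (d : ℤ) ∣ y - v).card
  have hdq : (0 : ℚ) < d := by exact_mod_cast hd
  have h1 := Int.floor_le ((((h : ℤ) : ℚ) - v) / ((d : ℤ) : ℚ))
  have h2 := Int.lt_floor_add_one ((((0 : ℤ) : ℚ) - v) / ((d : ℤ) : ℚ))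
  have h3 : (c : ℚ) ≤ h / d + 1 := by
    have : (c : ℤ) = _ := hc
    have hq : (c : ℚ) = ((c : ℤ) : ℚ) := by simp
    rw [hq, hc, Int.cast_max]
    apply max_le
    · push_cast at h1 h2 ⊢
      have h3 : ((h : ℚ) - v) / d = h / d + (0 - v) / d := by ring
      linarith
    · push_cast; positivity
  have h4 : (c : ℚ) * d ≤ h + d := by
    calc (c : ℚ) * d ≤ (h / d + 1) * d := by gcongr
      _ = h + d := by field_simp
  have h5 : c * d ≤ h + d := by exact_mod_cast h4
  omega

theorem Int.card_le_two_mul_card_divisors {P : ℤ} (hP : P ≠ 0) (s : Finset ℤ)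
    (hs : ∀ z ∈ s, z ∣ P) : s.card ≤ 2 * P.natAbs.divisors.card := by
  have hsub : s ⊆ (P.natAbs.divisors.image fun n : ℕ => (n : ℤ)) ∪
      (P.natAbs.divisors.image fun n : ℕ => -(n : ℤ)) := by
    intro z hz
    have hz' : z.natAbs ∈ P.natAbs.divisors := by
      simpa [Nat.mem_divisors, hP] using Int.natAbs_dvd_natAbs.2 (hs z hz)
    simp only [Finset.mem_union, Finset.mem_image]
    rcases Int.natAbs_eq z with hz | hz
    · exact Or.inl ⟨_, hz', hz.symm⟩
    · exact Or.inr ⟨_, hz', hz.symm⟩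
  refine (Finset.card_le_card hsub).trans ((Finset.card_union_le _ _).trans ?_)
  have := Finset.card_image_le (s := P.natAbs.divisors) (f := fun n : ℕ => (n : ℤ))
  have := Finset.card_image_le (s := P.natAbs.divisors) (f := fun n : ℕ => -(n : ℤ))
  omega

/-- Pairs of disjoint tuples `x`, `y` in `[1, h]` for which the products of the `r * x i + t` and of
the `r * y i + t` agree and do not vanish. -/
noncomputable def disjointSolutions (ν h : ℕ) (r t : ℤ) : Finset ((Fin ν → ℤ) × (Fin ν → ℤ)) :=
  ((Fintype.piFinset fun _ => Finset.Icc (1 : ℤ) h) ×ˢ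
    Fintype.piFinset fun _ => Finset.Icc (1 : ℤ) h).filter fun xy =>
      ∏ i, (r * xy.1 i + t) = ∏ i, (r * xy.2 i + t) ∧ ∏ i, (r * xy.1 i + t) ≠ 0 ∧
        ∀ i j, xy.1 i ≠ xy.2 j

section

variable {ν h : ℕ} {r t : ℤ} {x y : Fin ν → ℤ}

theorem mem_disjointSolutions : (x, y) ∈ disjointSolutions ν h r t ↔
    ((∀ i, 1 ≤ x i ∧ x i ≤ h) ∧ ∀ i, 1 ≤ y i ∧ y i ≤ h) ∧
      ∏ i, (r * x i + t) = ∏ i, (r * y i + t) ∧ ∏ i, (r * x i + t) ≠ 0 ∧ ∀ i j, x i ≠ y j := by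
  simp [disjointSolutions]

theorem swap_mem_disjointSolutions (hxy : (x, y) ∈ disjointSolutions ν h r t) :
    (y, x) ∈ disjointSolutions ν h r t := by
  rw [mem_disjointSolutions] at hxy ⊢
  obtain ⟨⟨hx, hy⟩, he, hne, hd⟩ := hxy
  exact ⟨⟨hy, hx⟩, he.symm, he ▸ hne, fun i j => (hd j i).symm⟩

theorem exists_dvd_sub_of_mem_disjointSolutions (hrt : IsCoprime r t)
    (hxy : (x, y) ∈ disjointSolutions ν h r t) (i : Fin ν) :
    ∃ d : Fin ν → ℕ, (∀ j, 0 < d j ∧ d j ≤ h ∧ (d j : ℤ) ∣ y j - x i) ∧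
      ∏ j, d j = (r * x i + t).natAbs := by
  rw [mem_disjointSolutions] at hxy
  obtain ⟨⟨hx, hy⟩, he, hne, hd⟩ := hxy
  have hdvd : (r * x i + t).natAbs ∣ ∏ j, (r * y j + t).natAbs := by
    rw [← Int.natAbs_finset_prod, Int.natAbs_dvd_natAbs, ← he]
    exact Finset.dvd_prod_of_mem _ (Finset.mem_univ i)
  obtain ⟨d, hd1, hd2⟩ := exists_forall_dvd_prod_eq_of_dvd_prod _ _ _ hdvd
  have hpos : ∀ j, 0 < d j := by
    intro j
    apply Nat.pos_of_ne_zero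
    intro h0
    apply hne
    have : ∏ j, d j = 0 := Finset.prod_eq_zero (Finset.mem_univ j) h0
    rw [hd2, Int.natAbs_eq_zero] at this
    exact Finset.prod_eq_zero (Finset.mem_univ i) this
  have hdiff : ∀ j, (d j : ℤ) ∣ y j - x i := by
    intro j
    have ha : (d j : ℤ) ∣ r * x i + t := by
      rw [Int.natCast_dvd, ← hd2]
      exact Finset.dvd_prod_of_mem _ (Finset.mem_univ j)
    have hb : (d j : ℤ) ∣ r * y j + t := Int.natCast_dvd.2 (hd1 j (Finset.mem_univ j))
    have hcop : IsCoprime (d j : ℤ) r := by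
      refine IsCoprime.of_isCoprime_of_dvd_left ?_ ha
      have := hrt.symm.add_mul_left_left (x i)
      rwa [add_comm]
    refine hcop.dvd_of_dvd_mul_left ?_
    have := dvd_sub hb ha
    convert this using 1
    ring
  refine ⟨d, fun j => ⟨hpos j, ?_, hdiff j⟩, hd2⟩
  have hne' : y j - x i ≠ 0 := sub_ne_zero.2 (hd i j).symm
  have h1 : d j ≤ (y j - x i).natAbs :=
    Nat.le_of_dvd (Int.natAbs_pos.2 hne') (Int.natCast_dvd.1 (hdiff j))
  have := hx i
  have := hy j
  omega

theorem natAbs_le_of_mem_disjointSolutions (hrt : IsCoprime r t)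
    (hxy : (x, y) ∈ disjointSolutions ν h r t) (i : Fin ν) :
    (r * x i + t).natAbs ≤ h ^ ν := by
  obtain ⟨d, hd, hprod⟩ := exists_dvd_sub_of_mem_disjointSolutions hrt hxy i
  rw [← hprod]
  calc ∏ j, d j ≤ ∏ _j : Fin ν, h := Finset.prod_le_prod' fun j _ => (hd j).2.1
    _ = h ^ ν := by simp

theorem card_filter_snd_disjointSolutions_le (hr : r ≠ 0) (hrt : IsCoprime r t) {D : ℕ}
    (hD : ∀ n : ℕ, n ≠ 0 → n ≤ h ^ (ν * ν) → n.divisors.card ≤ D) (y : Fin ν → ℤ) :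
    ((disjointSolutions ν h r t).filter fun xy => xy.2 = y).card ≤ (2 * D) ^ ν := by
  rcases ((disjointSolutions ν h r t).filter fun xy => xy.2 = y).eq_empty_or_nonempty with h0 | h0
  · simp [h0]
  obtain ⟨⟨x, y'⟩, hmem⟩ := h0
  obtain ⟨hxy, hy : y' = y⟩ := Finset.mem_filter.1 hmem
  subst hy
  set P := ∏ j, (r * y' j + t) with hP
  have hP0 : P ≠ 0 := by
    have := mem_disjointSolutions.1 hxy
    rw [hP, ← this.2.1]
    exact this.2.2.1
  have hPle : P.natAbs ≤ h ^ (ν * ν) := by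
    rw [hP, Int.natAbs_finset_prod, pow_mul]
    calc ∏ j, (r * y' j + t).natAbs ≤ ∏ _j : Fin ν, h ^ ν := Finset.prod_le_prod' fun j _ =>
          natAbs_le_of_mem_disjointSolutions hrt (swap_mem_disjointSolutions hxy) j
      _ = (h ^ ν) ^ ν := by simp
  set A := (Finset.Icc (1 : ℤ) h).filter fun z => r * z + t ∣ P with hA
  have hAcard : A.card ≤ 2 * D := by
    have hinj : Function.Injective fun z : ℤ => r * z + t := fun a b hab => by simpa [hr] using hab
    rw [← Finset.card_image_of_injective A hinj]
    refine (Int.card_le_two_mul_card_divisors hP0 _ ?_).trans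
      (Nat.mul_le_mul_left 2 (hD _ (Int.natAbs_ne_zero.2 hP0) hPle))
    intro z hz
    obtain ⟨w, hw, rfl⟩ := Finset.mem_image.1 hz
    exact (Finset.mem_filter.1 hw).2
  calc _ ≤ (Fintype.piFinset fun _ : Fin ν => A).card := by
        refine Finset.card_le_card_of_injOn Prod.fst ?_ ?_
        · rintro ⟨u, v⟩ huv
          obtain ⟨huvS, hv : v = y'⟩ := Finset.mem_filter.1 huv
          subst hv
          obtain ⟨⟨hu, -⟩, he, -⟩ := mem_disjointSolutions.1 huvS
          simp only [Finset.mem_coe, Fintype.mem_piFinset, hA, Finset.mem_filter, Finset.mem_Icc]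
          refine fun i => ⟨hu i, ?_⟩
          rw [hP, ← he]
          exact Finset.dvd_prod_of_mem (fun i => r * u i + t) (Finset.mem_univ i)
        · rintro ⟨u, v⟩ huv ⟨u', v'⟩ huv' huu
          simp only [Finset.coe_filter, Set.mem_ofPred_eq] at huv huv'
          exact Prod.ext huu (huv.2.trans huv'.2.symm)
    _ = A.card ^ ν := by simp
    _ ≤ (2 * D) ^ ν := by gcongr

theorem card_filter_fst_disjointSolutions_mul_le (hr : r ≠ 0) (hrt : IsCoprime r t) {D : ℕ}
    (hD : ∀ n : ℕ, n ≠ 0 → n ≤ h ^ (ν * ν) → n.divisors.card ≤ D) (i : Fin ν) (a : ℤ) :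
    ((disjointSolutions ν h r t).filter fun xy => xy.1 i = a).card * (r * a + t).natAbs ≤
      D ^ ν * ((2 * h) ^ ν * (2 * D) ^ ν) := by
  classical
  rcases ((disjointSolutions ν h r t).filter fun xy => xy.1 i = a).eq_empty_or_nonempty with h0 | h0
  · simp [h0]
  obtain ⟨⟨x, y⟩, hmem⟩ := h0
  obtain ⟨hxy, hx : x i = a⟩ := Finset.mem_filter.1 hmem
  subst hx
  set n := (r * x i + t).natAbs with hn
  have hn0 : n ≠ 0 := fun hn0 => (mem_disjointSolutions.1 hxy).2.2.1
    (Finset.prod_eq_zero (Finset.mem_univ i) (Int.natAbs_eq_zero.1 hn0))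
  have hnle : n ≤ h ^ (ν * ν) := by
    have h1 := natAbs_le_of_mem_disjointSolutions hrt hxy i
    have hh : 0 < h := by
      have := (mem_disjointSolutions.1 hxy).1.1 i
      omega
    exact h1.trans (Nat.pow_le_pow_right hh (Nat.le_mul_of_pos_left _ i.pos))
  set T := (Fintype.piFinset fun _ : Fin ν => n.divisors).filter
    fun d => (∀ j, 0 < d j ∧ d j ≤ h) ∧ ∏ j, d j = n with hT
  set Y : (Fin ν → ℕ) → Finset (Fin ν → ℤ) := fun d => Fintype.piFinset fun j =>
    (Finset.Icc (1 : ℤ) h).filter fun z => (d j : ℤ) ∣ z - x i with hY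
  have hTcard : T.card ≤ D ^ ν := by
    calc T.card ≤ (Fintype.piFinset fun _ : Fin ν => n.divisors).card :=
          Finset.card_filter_le _ _
      _ = n.divisors.card ^ ν := by simp
      _ ≤ D ^ ν := by gcongr; exact hD n hn0 hnle
  have hYcard : ∀ d ∈ T, (Y d).card * n ≤ (2 * h) ^ ν := by
    intro d hd
    obtain ⟨-, hd, hprod⟩ := Finset.mem_filter.1 hd
    rw [← hprod, hY, Fintype.card_piFinset, ← Finset.prod_mul_distrib]
    calc _ ≤ ∏ _j : Fin ν, 2 * h := Finset.prod_le_prod' fun j _ =>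
          card_filter_dvd_sub_mul_le (hd j).1 (hd j).2 _
      _ = (2 * h) ^ ν := by simp
  have hsub : ((disjointSolutions ν h r t).filter fun xy => xy.1 i = x i) ⊆
      T.biUnion fun d => (Y d).biUnion fun v =>
        (disjointSolutions ν h r t).filter fun xy => xy.2 = v := by
    rintro ⟨u, v⟩ huv
    obtain ⟨huv, hui : u i = x i⟩ := Finset.mem_filter.1 huv
    obtain ⟨d, hd, hprod⟩ := exists_dvd_sub_of_mem_disjointSolutions hrt huv i
    rw [hui] at hd hprod
    have hv := (mem_disjointSolutions.1 huv).1.2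
    refine Finset.mem_biUnion.2 ⟨d, ?_, Finset.mem_biUnion.2 ⟨v, ?_, ?_⟩⟩
    · refine Finset.mem_filter.2 ⟨?_, fun j => ⟨(hd j).1, (hd j).2.1⟩, hprod⟩
      refine Fintype.mem_piFinset.2 fun j => Nat.mem_divisors.2 ⟨?_, hn0⟩
      rw [hn, ← hprod]
      exact Finset.dvd_prod_of_mem _ (Finset.mem_univ j)
    · refine Fintype.mem_piFinset.2 fun j => Finset.mem_filter.2 ⟨?_, (hd j).2.2⟩
      exact Finset.mem_Icc.2 (hv j)
    · exact Finset.mem_filter.2 ⟨huv, rfl⟩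
  calc _ ≤ (∑ d ∈ T, (Y d).card * (2 * D) ^ ν) * n := by
        gcongr
        refine (Finset.card_le_card hsub).trans (Finset.card_biUnion_le.trans ?_)
        refine Finset.sum_le_sum fun d _ => Finset.card_biUnion_le_card_mul _ _ _ fun v _ => ?_
        exact card_filter_snd_disjointSolutions_le hr hrt hD v
    _ = ∑ d ∈ T, (Y d).card * n * (2 * D) ^ ν := by
        rw [Finset.sum_mul]
        exact Finset.sum_congr rfl fun d _ => by ring
    _ ≤ ∑ _d ∈ T, (2 * h) ^ ν * (2 * D) ^ ν := Finset.sum_le_sum fun d hd => by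
        gcongr
        exact hYcard d hd
    _ = T.card * ((2 * h) ^ ν * (2 * D) ^ ν) := by simp
    _ ≤ _ := by gcongr

end

theorem Real.one_lt_log_of_three_le {h : ℕ} (hh : 3 ≤ h) : 1 < Real.log h := by
  rw [Real.lt_log_iff_exp_lt (by positivity)]
  have : (3 : ℝ) ≤ h := by exact_mod_cast hh
  linarith [Real.exp_one_lt_d9]

theorem Real.log_le_two_mul_sqrt {L : ℝ} (hL : 0 < L) : Real.log L ≤ 2 * √L := by
  have h1 : Real.log L = 2 * Real.log √L := by rw [Real.log_sqrt hL.le]; ring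
  linarith [Real.log_le_sub_one_of_pos (Real.sqrt_pos.2 hL)]

theorem Real.sqrt_mul_log_le_div_log {L : ℝ} (hL : 1 < L) :
    √L * Real.log L ≤ 16 * (L / Real.log L) := by
  have hl : 0 < Real.log L := Real.log_pos hL
  have hs : 0 < √L := Real.sqrt_pos.2 (by linarith)
  have h1 : Real.log L = 2 * Real.log √L := by rw [Real.log_sqrt (by linarith)]; ring
  have h2 := Real.log_le_two_mul_sqrt hs
  have h3 : Real.log L ^ 2 ≤ 16 * √L := by
    calc Real.log L ^ 2 ≤ (4 * √√L) ^ 2 := by gcongr; linarith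
      _ = 16 * √L := by rw [mul_pow, Real.sq_sqrt hs.le]; norm_num
  rw [← mul_div_assoc, le_div_iff₀ hl]
  calc √L * Real.log L * Real.log L = √L * Real.log L ^ 2 := by ring
    _ ≤ √L * (16 * √L) := by gcongr
    _ = 16 * L := by
      have := Real.mul_self_sqrt (show 0 ≤ L by linarith)
      linear_combination 16 * this

theorem Real.sqrt_le_two_mul_div_log {L : ℝ} (hL : 1 < L) : √L ≤ 2 * (L / Real.log L) := by
  have hl : 0 < Real.log L := Real.log_pos hL
  have hs : 0 < √L := Real.sqrt_pos.2 (by linarith)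
  rw [← mul_div_assoc, le_div_iff₀ hl]
  calc √L * Real.log L ≤ √L * (2 * √L) := by
        gcongr
        exact Real.log_le_two_mul_sqrt (by linarith)
    _ = 2 * L := by
      have := Real.mul_self_sqrt (show 0 ≤ L by linarith)
      linear_combination 2 * this

theorem Real.one_le_div_log {L : ℝ} (hL : 1 < L) : 1 ≤ L / Real.log L := by
  have hl : 0 < Real.log L := Real.log_pos hL
  rw [le_div_iff₀ hl]
  linarith [Real.log_le_sub_one_of_pos (show 0 < L by linarith)]

theorem Real.one_add_le_exp_div_log {L : ℝ} (hL : 1 < L) :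
    1 + L ≤ Real.exp (5 * (L / Real.log L)) := by
  have hl : 0 < Real.log L := Real.log_pos hL
  have hs1 := Real.sqrt_le_two_mul_div_log hL
  have hs2 := Real.log_le_two_mul_sqrt (show 0 < L by linarith)
  have h1 := Real.one_le_div_log hL
  calc 1 + L ≤ 2 * L := by linarith
    _ ≤ Real.exp 1 * Real.exp (Real.log L) := by
        rw [Real.exp_log (by linarith)]
        gcongr
        linarith [Real.add_one_le_exp 1]
    _ = Real.exp (1 + Real.log L) := (Real.exp_add _ _).symm
    _ ≤ _ := Real.exp_le_exp.2 (by linarith)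

theorem Nat.card_divisors_le_exp_log_div_log_log {A : ℝ} (hA : 1 ≤ A) :
    ∃ C : ℝ, 0 < C ∧ ∀ h : ℕ, 3 ≤ h → ∀ n : ℕ, n ≠ 0 → Real.log n ≤ A * Real.log h →
      (n.divisors.card : ℝ) ≤ Real.exp (C * (Real.log h / Real.log (Real.log h))) := by
  have hlA : 0 ≤ Real.log (3 * A) := Real.log_nonneg (by linarith)
  refine ⟨2 * Real.log (3 * A) + 16 + 2 * A, by positivity, fun h hh n hn hnA => ?_⟩
  have hL := Real.one_lt_log_of_three_le hh
  set L := Real.log h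
  set l := Real.log L with hldef
  have hl : 0 < l := Real.log_pos hL
  have hAL : 1 ≤ 3 * A * L := by nlinarith
  have hK : (0 : ℝ) < √L := Real.sqrt_pos.2 (by linarith)
  have hfac : Real.log n = ∑ p ∈ n.primeFactors, (n.factorization p : ℝ) * Real.log p := by
    rw [Real.log_nat_eq_sum_factorization]; rfl
  have hpt : ∀ p ∈ n.primeFactors, (n.factorization p : ℝ) + 1 ≤
      (if (p : ℝ) ≤ √L then 3 * A * L else 1) *
        Real.exp (2 / l * ((n.factorization p : ℝ) * Real.log p)) := by
    intro p hp
    have hp2 : 2 ≤ p := (Nat.prime_of_mem_primeFactors hp).two_le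
    have hp2' : (2 : ℝ) ≤ p := by exact_mod_cast hp2
    have hlogp : Real.log 2 ≤ Real.log p := Real.log_le_log (by norm_num) hp2'
    have hlog2 := Real.log_two_gt_d9
    have hterm : (n.factorization p : ℝ) * Real.log p ≤ Real.log n := by
      rw [hfac]
      exact Finset.single_le_sum (f := fun p : ℕ => (n.factorization p : ℝ) * Real.log p)
        (fun q _ => mul_nonneg (Nat.cast_nonneg _) (Real.log_natCast_nonneg q)) hp
    set e : ℝ := (n.factorization p : ℝ)
    have he : 0 ≤ e := Nat.cast_nonneg _
    split_ifs with hpK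
    · have h1 : e + 1 ≤ 3 * A * L := by nlinarith
      have h2 : 1 ≤ Real.exp (2 / l * (e * Real.log p)) := by
        apply Real.one_le_exp
        have : 0 ≤ Real.log p := by linarith
        positivity
      nlinarith
    · push Not at hpK
      have h1 : l / 2 ≤ Real.log p := by
        rw [hldef, ← Real.log_sqrt (by linarith)]
        exact Real.log_le_log hK hpK.le
      have h2 : e ≤ 2 / l * (e * Real.log p) := by
        calc e = 2 / l * (e * (l / 2)) := by field_simp
          _ ≤ _ := by gcongr
      rw [one_mul]
      exact (Real.add_one_le_exp e).trans (Real.exp_le_exp.2 h2)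
  have hsmall : ((n.primeFactors.filter fun p : ℕ => (p : ℝ) ≤ √L).card : ℝ) ≤ √L := by
    calc ((n.primeFactors.filter fun p : ℕ => (p : ℝ) ≤ √L).card : ℝ)
        ≤ ((Finset.Ioc 0 ⌊√L⌋₊).card : ℝ) := by
          gcongr
          intro p hp
          obtain ⟨hp, hpK⟩ := Finset.mem_filter.1 hp
          exact Finset.mem_Ioc.2 ⟨(Nat.prime_of_mem_primeFactors hp).pos, Nat.le_floor hpK⟩
      _ ≤ √L := by simpa using Nat.floor_le hK.le
  calc (n.divisors.card : ℝ) = ∏ p ∈ n.primeFactors, ((n.factorization p : ℝ) + 1) := by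
        rw [Nat.card_divisors hn]; push_cast; rfl
    _ ≤ ∏ p ∈ n.primeFactors, (if (p : ℝ) ≤ √L then 3 * A * L else 1) *
        Real.exp (2 / l * ((n.factorization p : ℝ) * Real.log p)) :=
        Finset.prod_le_prod (fun _ _ => by positivity) hpt
    _ = (3 * A * L) ^ (n.primeFactors.filter fun p : ℕ => (p : ℝ) ≤ √L).card *
        Real.exp (2 / l * Real.log n) := by
        rw [Finset.prod_mul_distrib, ← Real.exp_sum, ← Finset.mul_sum, ← hfac, Finset.prod_ite]
        simp
    _ ≤ Real.exp (√L * (Real.log (3 * A) + l)) * Real.exp (2 / l * (A * L)) := by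
        gcongr
        rw [← Real.rpow_natCast, Real.rpow_def_of_pos (by linarith), mul_comm √L,
          Real.log_mul (by linarith) (by linarith)]
        gcongr
    _ = Real.exp (√L * Real.log (3 * A) + √L * l + 2 * A * (L / l)) := by
        rw [← Real.exp_add]; congr 1; ring
    _ ≤ _ := by
        rw [Real.exp_le_exp]
        have h1 := Real.sqrt_mul_log_le_div_log hL
        have h2 := mul_le_mul_of_nonneg_right (Real.sqrt_le_two_mul_div_log hL) hlA
        linarith

theorem Int.sum_inv_abs_add_one_le (h : ℕ) (s : Finset ℤ) (hs : s.card ≤ h) :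
    ∑ m ∈ s, (1 : ℝ) / (|(m : ℝ)| + 1) ≤ 1 + 2 * (1 + Real.log h) := by
  rcases Nat.eq_zero_or_pos h with rfl | hh
  · have : s = ∅ := by simpa using hs
    simp only [this, Finset.sum_empty, Nat.cast_zero, Real.log_zero]
    norm_num
  have hharm : ∑ n ∈ Finset.range h, (1 : ℝ) / ((n : ℝ) + 1) ≤ 1 + Real.log h := by
    have := harmonic_le_one_add_log h
    simpa [harmonic] using this
  have hpt : ∀ m ∈ s, (1 : ℝ) / (|(m : ℝ)| + 1) ≤ 1 / h +
      if m.natAbs < h then (1 : ℝ) / (|(m : ℝ)| + 1) else 0 := by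
    intro m _
    split_ifs with hm
    · have : (0 : ℝ) ≤ 1 / h := by positivity
      linarith
    · rw [add_zero]
      have : (h : ℝ) ≤ |(m : ℝ)| := by
        rw [← Int.cast_abs, Int.abs_eq_natAbs]
        exact_mod_cast not_lt.1 hm
      gcongr
      linarith
  have himg : s.filter (fun m => m.natAbs < h) ⊆
      ((Finset.range h).image fun n : ℕ => (n : ℤ)) ∪
        ((Finset.range h).image fun n : ℕ => -(n : ℤ)) := by
    intro m hm
    have hm := (Finset.mem_filter.1 hm).2
    simp only [Finset.mem_union, Finset.mem_image, Finset.mem_range]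
    rcases Int.natAbs_eq m with h' | h'
    · exact Or.inl ⟨_, hm, h'.symm⟩
    · exact Or.inr ⟨_, hm, h'.symm⟩
  have hmain : ∑ m ∈ s.filter (fun m => m.natAbs < h), (1 : ℝ) / (|(m : ℝ)| + 1) ≤
      2 * (1 + Real.log h) := by
    calc _ ≤ ∑ m ∈ ((Finset.range h).image fun n : ℕ => (n : ℤ)) ∪
        ((Finset.range h).image fun n : ℕ => -(n : ℤ)), (1 : ℝ) / (|(m : ℝ)| + 1) :=
          Finset.sum_le_sum_of_subset_of_nonneg himg fun _ _ _ => by positivity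
      _ ≤ ∑ m ∈ (Finset.range h).image fun n : ℕ => (n : ℤ), (1 : ℝ) / (|(m : ℝ)| + 1) +
          ∑ m ∈ (Finset.range h).image fun n : ℕ => -(n : ℤ), (1 : ℝ) / (|(m : ℝ)| + 1) := by
          rw [← Finset.sum_union_inter]
          exact le_add_of_nonneg_right (Finset.sum_nonneg fun _ _ => by positivity)
      _ = 2 * ∑ n ∈ Finset.range h, (1 : ℝ) / ((n : ℝ) + 1) := by
          rw [Finset.sum_image (by simp), Finset.sum_image (by simp)]
          simp
          ring
      _ ≤ _ := by gcongr
  calc _ ≤ ∑ m ∈ s, ((1 : ℝ) / h + if m.natAbs < h then (1 : ℝ) / (|(m : ℝ)| + 1) else 0) :=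
        Finset.sum_le_sum hpt
    _ = s.card * (1 / h) + ∑ m ∈ s.filter (fun m => m.natAbs < h), (1 : ℝ) / (|(m : ℝ)| + 1) := by
        rw [Finset.sum_add_distrib, Finset.sum_filter]; simp
    _ ≤ h * (1 / h) + 2 * (1 + Real.log h) := by gcongr
    _ = _ := by
        have : (h : ℝ) ≠ 0 := by positivity
        field_simp

theorem sum_inv_abs_linear_le {h : ℕ} (hh : 3 ≤ h) {r : ℤ} (hr : 1 ≤ r) (t : ℤ) :
    ∑ x ∈ (Finset.Icc (1 : ℤ) h).filter (fun x => r ≤ 2 * |r * x + t|),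
      (1 : ℝ) / |((r * x + t : ℤ) : ℝ)| ≤
        24 * (1 + Real.log h) * (h / max ((h : ℝ) * r) |(t : ℝ)|) := by
  have hL := Real.one_lt_log_of_three_le hh
  have hh0 : (0 : ℝ) < h := by positivity
  have hr0 : (0 : ℝ) < r := by exact_mod_cast (by omega : 0 < r)
  set s := (Finset.Icc (1 : ℤ) h).filter (fun x => r ≤ 2 * |r * x + t|) with hs
  have hcard : s.card ≤ h := (Finset.card_filter_le _ _).trans (by simp)
  rcases le_total (2 * ((h : ℝ) * r)) |(t : ℝ)| with hc | hc
  · have ht : 0 < |(t : ℝ)| := lt_of_lt_of_le (by positivity) hc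
    have hpt : ∀ x ∈ s, (1 : ℝ) / |((r * x + t : ℤ) : ℝ)| ≤ 2 / |(t : ℝ)| := by
      intro x hx
      obtain ⟨hx1, hx2⟩ := Finset.mem_Icc.1 (Finset.mem_filter.1 hx).1
      have hx1' : (1 : ℝ) ≤ x := by exact_mod_cast hx1
      have hx2' : (x : ℝ) ≤ h := by exact_mod_cast hx2
      have h1 : |(t : ℝ)| / 2 ≤ |((r * x + t : ℤ) : ℝ)| := by
        have h2 : |(t : ℝ)| ≤ |((r * x + t : ℤ) : ℝ)| + |(r : ℝ) * x| := by
          have := abs_sub ((r * x + t : ℤ) : ℝ) ((r : ℝ) * x)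
          push_cast at this ⊢
          simpa using this
        have h3 : |(r : ℝ) * x| ≤ h * r := by
          rw [abs_of_nonneg (by positivity)]
          nlinarith
        linarith
      calc (1 : ℝ) / |((r * x + t : ℤ) : ℝ)| ≤ 1 / (|(t : ℝ)| / 2) := by gcongr
        _ = _ := by field_simp
    rw [max_eq_right (by linarith [mul_pos hh0 hr0])]
    calc _ ≤ s.card • (2 / |(t : ℝ)|) := Finset.sum_le_card_nsmul _ _ _ hpt
      _ ≤ h * (2 / |(t : ℝ)|) := by rw [nsmul_eq_mul]; gcongr
      _ = 2 * (h / |(t : ℝ)|) := by ring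
      _ ≤ _ := by gcongr; linarith
  · have hmax : max ((h : ℝ) * r) |(t : ℝ)| ≤ 2 * (h * r) :=
      max_le (by linarith [mul_pos hh0 hr0]) hc
    have hmaxpos : 0 < max ((h : ℝ) * r) |(t : ℝ)| := lt_max_of_lt_left (by positivity)
    have hpt : ∀ x ∈ s, (1 : ℝ) / |((r * x + t : ℤ) : ℝ)| ≤
        4 / r * (1 / (|((x + t / r : ℤ) : ℝ)| + 1)) := by
      intro x hx
      have hx := (Finset.mem_filter.1 hx).2
      have hm : r * (|x + t / r| + 1) ≤ 4 * |r * x + t| := by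
        have e1 := Int.emod_add_mul_ediv t r
        have e2 := Int.emod_nonneg t (by omega : r ≠ 0)
        have e3 := Int.emod_lt_of_pos t (by omega : 0 < r)
        set m := x + t / r with hm
        have e4 : r * x + t = r * m + t % r := by rw [hm]; linear_combination -e1
        rw [e4] at hx ⊢
        rcases le_or_gt 1 m with h1 | h1
        · rw [abs_of_nonneg (by omega : 0 ≤ m), abs_of_nonneg (by nlinarith)]
          nlinarith
        rcases le_or_gt (-1) m with h2 | h2
        · have : |m| ≤ 1 := abs_le.2 ⟨h2, by omega⟩
          nlinarith
        · rw [abs_of_nonpos (by omega : m ≤ 0), abs_of_nonpos (by nlinarith)]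
          nlinarith
      have hm' : (r : ℝ) * (|((x + t / r : ℤ) : ℝ)| + 1) ≤ 4 * |((r * x + t : ℤ) : ℝ)| := by
        rw [← Int.cast_abs, ← Int.cast_abs]
        exact_mod_cast hm
      have hp : (0 : ℝ) < |((r * x + t : ℤ) : ℝ)| := by
        have : (0 : ℝ) < r * (|((x + t / r : ℤ) : ℝ)| + 1) := by positivity
        linarith
      rw [div_mul_div_comm, mul_one, div_le_div_iff₀ hp (by positivity)]
      linarith
    have hsum : ∑ x ∈ s, (1 : ℝ) / (|((x + t / r : ℤ) : ℝ)| + 1) ≤ 3 * (1 + Real.log h) := by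
      have hinj : Function.Injective fun x : ℤ => x + t / r := add_left_injective _
      have := Int.sum_inv_abs_add_one_le h (s.image fun x => x + t / r)
        (Finset.card_image_le.trans hcard)
      rw [Finset.sum_image hinj.injOn] at this
      linarith
    calc _ ≤ ∑ x ∈ s, 4 / r * ((1 : ℝ) / (|((x + t / r : ℤ) : ℝ)| + 1)) := Finset.sum_le_sum hpt
      _ ≤ 4 / r * (3 * (1 + Real.log h)) := by rw [← Finset.mul_sum]; gcongr
      _ = 24 * (1 + Real.log h) * (h / (2 * (h * r))) := by field_simp; norm_num
      _ ≤ _ := by gcongr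

theorem card_disjointSolutions_le {ν h : ℕ} {r t : ℤ} (hh : 3 ≤ h) (hr : 1 ≤ r)
    (hrt : IsCoprime r t) {D : ℕ}
    (hD : ∀ n : ℕ, n ≠ 0 → n ≤ h ^ (ν * ν) → n.divisors.card ≤ D) (i : Fin ν) :
    ((disjointSolutions ν h r t).card : ℝ) ≤
      2 * ((D : ℝ) ^ ν * ((2 * h) ^ ν * (2 * D) ^ ν) *
        (24 * (1 + Real.log h) * (h / max ((h : ℝ) * r) |(t : ℝ)|))) := by
  classical
  set S := disjointSolutions ν h r t with hS
  set s := (Finset.Icc (1 : ℤ) h).filter (fun x => r ≤ 2 * |r * x + t|) with hs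
  set B : ℝ := (D : ℝ) ^ ν * ((2 * h) ^ ν * (2 * D) ^ ν) with hB
  set F := S.filter fun xy => r ≤ 2 * |r * xy.1 i + t| with hF
  have hcover : S ⊆ F ∪ F.image Prod.swap := by
    rintro ⟨x, y⟩ hxy
    rw [Finset.mem_union, Finset.mem_image]
    by_cases hx : r ≤ 2 * |r * x i + t|
    · exact Or.inl (Finset.mem_filter.2 ⟨hxy, hx⟩)
    · refine Or.inr ⟨(y, x), Finset.mem_filter.2 ⟨swap_mem_disjointSolutions hxy, ?_⟩, rfl⟩
      have hne : x i - y i ≠ 0 := sub_ne_zero.2 ((mem_disjointSolutions.1 hxy).2.2.2 i i)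
      have h1 : r ≤ |r * (x i - y i)| := by
        rw [abs_mul, abs_of_pos (by omega : 0 < r)]
        nlinarith [Int.one_le_abs hne]
      have h2 : |r * (x i - y i)| ≤ |r * x i + t| + |r * y i + t| := by
        have := abs_sub (r * x i + t) (r * y i + t)
        rwa [show r * x i + t - (r * y i + t) = r * (x i - y i) by ring] at this
      dsimp only
      omega
  have hcard : S.card ≤ 2 * F.card := by
    have h1 := (Finset.card_le_card hcover).trans (Finset.card_union_le _ _)
    have h2 := Finset.card_image_le (s := F) (f := Prod.swap)
    omega
  have hFsub : F ⊆ s.biUnion fun a => S.filter fun xy => xy.1 i = a := by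
    rintro ⟨x, y⟩ hxy
    obtain ⟨hxy, hx⟩ := Finset.mem_filter.1 hxy
    refine Finset.mem_biUnion.2 ⟨x i, Finset.mem_filter.2 ⟨Finset.mem_Icc.2 ?_, hx⟩,
      Finset.mem_filter.2 ⟨hxy, rfl⟩⟩
    exact (mem_disjointSolutions.1 hxy).1.1 i
  have hfib : ∀ a ∈ s, ((S.filter fun xy => xy.1 i = a).card : ℝ) ≤
      B * (1 / |((r * a + t : ℤ) : ℝ)|) := by
    intro a ha
    have ha := (Finset.mem_filter.1 ha).2
    have hpos : 0 < |r * a + t| := by omega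
    have hpos' : (0 : ℝ) < |((r * a + t : ℤ) : ℝ)| := by
      rw [← Int.cast_abs]
      exact_mod_cast hpos
    have h1 := card_filter_fst_disjointSolutions_mul_le (by omega : r ≠ 0) hrt hD i a
    rw [mul_one_div, le_div_iff₀ hpos', ← Int.cast_abs, Int.abs_eq_natAbs, hB, Int.cast_natCast]
    exact_mod_cast h1
  calc (S.card : ℝ) ≤ 2 * F.card := by exact_mod_cast hcard
    _ ≤ 2 * ∑ a ∈ s, ((S.filter fun xy => xy.1 i = a).card : ℝ) := by
        gcongr
        exact_mod_cast (Finset.card_le_card hFsub).trans Finset.card_biUnion_le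
    _ ≤ 2 * ∑ a ∈ s, B * (1 / |((r * a + t : ℤ) : ℝ)|) := by
        gcongr with a ha
        exact hfib a ha
    _ ≤ _ := by
        rw [← Finset.mul_sum]
        gcongr
        exact sum_inv_abs_linear_le hh hr t


/-- For fixed `ν ≥ 1` there is `C = C(ν) > 0` such that for `h ≥ 3`, integers
`r ≥ 1` and `t` with `gcd(r,t) = 1`, and `σ = t/r`, the number of solutions of
`(x₁+σ)⋯(x_ν+σ) = (y₁+σ)⋯(y_ν+σ) ≠ 0` with `1 ≤ xᵢ, yᵢ ≤ h` and
`{x₁,…,x_ν} ∩ {y₁,…,y_ν} = ∅` is at most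
`(h^{ν+1} / max{h·r, |t|})·exp(C log h / log log h)`. -/
theorem stmt18 (ν : ℕ) (hν : 1 ≤ ν) :
    ∃ C : ℝ, 0 < C ∧ ∀ h : ℕ, 3 ≤ h → ∀ r t : ℤ, 1 ≤ r → IsCoprime r t →
      (Set.ncard {xy : (Fin ν → ℤ) × (Fin ν → ℤ) |
          (∀ i, 1 ≤ xy.1 i ∧ xy.1 i ≤ (h : ℤ)) ∧
          (∀ i, 1 ≤ xy.2 i ∧ xy.2 i ≤ (h : ℤ)) ∧
          (∏ i, ((xy.1 i : ℂ) + (t : ℂ) / (r : ℂ))) =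
            (∏ i, ((xy.2 i : ℂ) + (t : ℂ) / (r : ℂ))) ∧
          (∏ i, ((xy.1 i : ℂ) + (t : ℂ) / (r : ℂ))) ≠ 0 ∧
          (∀ i j, xy.1 i ≠ xy.2 j)} : ℝ)
        ≤ (h : ℝ) ^ (ν + 1) / max ((h : ℝ) * (r : ℝ)) (|t| : ℝ) *
            Real.exp (C * Real.log h / Real.log (Real.log h)) := by
  have hA : (1 : ℝ) ≤ ((ν * ν : ℕ) : ℝ) := by exact_mod_cast Nat.mul_pos hν hν
  obtain ⟨C₁, hC₁, hdiv⟩ := Nat.card_divisors_le_exp_log_div_log_log hA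
  refine ⟨48 * 4 ^ ν + 2 * ν * C₁ + 5, by positivity, fun h hh r t hr hrt => ?_⟩
  have hL := Real.one_lt_log_of_three_le hh
  set E := Real.log h / Real.log (Real.log h) with hE
  have hE1 : 1 ≤ E := Real.one_le_div_log hL
  have hr0 : (r : ℂ) ≠ 0 := by exact_mod_cast (by omega : r ≠ 0)
  have hD : ∀ n : ℕ, n ≠ 0 → n ≤ h ^ (ν * ν) → n.divisors.card ≤ ⌊Real.exp (C₁ * E)⌋₊ := by
    intro n hn hnh
    refine Nat.le_floor (hdiv h hh n hn ?_)
    rw [← Real.log_pow]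
    exact Real.log_le_log (by positivity) (by exact_mod_cast hnh)
  have hDle : (⌊Real.exp (C₁ * E)⌋₊ : ℝ) ≤ Real.exp (C₁ * E) := Nat.floor_le (Real.exp_pos _).le
  have hcast : ∀ z : Fin ν → ℤ, ((∏ i, (r * z i + t) : ℤ) : ℂ) =
      (r : ℂ) ^ ν * ∏ i, ((z i : ℂ) + (t : ℂ) / (r : ℂ)) := by
    intro z
    calc ((∏ i, (r * z i + t) : ℤ) : ℂ) = ∏ i, (r : ℂ) * ((z i : ℂ) + (t : ℂ) / (r : ℂ)) := by
          push_cast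
          exact Finset.prod_congr rfl fun i _ => by field_simp
      _ = _ := by simp [Finset.prod_mul_distrib]
  have hncard := Set.ncard_le_ncard (t := (disjointSolutions ν h r t : Set _))
    (s := {xy : (Fin ν → ℤ) × (Fin ν → ℤ) |
          (∀ i, 1 ≤ xy.1 i ∧ xy.1 i ≤ (h : ℤ)) ∧
          (∀ i, 1 ≤ xy.2 i ∧ xy.2 i ≤ (h : ℤ)) ∧
          (∏ i, ((xy.1 i : ℂ) + (t : ℂ) / (r : ℂ))) =
            (∏ i, ((xy.2 i : ℂ) + (t : ℂ) / (r : ℂ))) ∧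
          (∏ i, ((xy.1 i : ℂ) + (t : ℂ) / (r : ℂ))) ≠ 0 ∧
          (∀ i j, xy.1 i ≠ xy.2 j)}) (by
      rintro ⟨x, y⟩ ⟨hx, hy, he, hne, hd⟩
      refine mem_disjointSolutions.2 ⟨⟨hx, hy⟩, ?_, ?_, hd⟩
      · have : ((∏ i, (r * x i + t) : ℤ) : ℂ) = ((∏ i, (r * y i + t) : ℤ) : ℂ) := by
          rw [hcast, hcast]
          exact congrArg _ he
        exact_mod_cast this
      · have : ((∏ i, (r * x i + t) : ℤ) : ℂ) ≠ 0 := by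
          rw [hcast]
          exact mul_ne_zero (pow_ne_zero _ hr0) hne
        exact_mod_cast this) (Finset.finite_toSet _)
  rw [Set.ncard_coe_finset] at hncard
  refine (Nat.cast_le.2 hncard).trans
    ((card_disjointSolutions_le hh hr hrt hD ⟨0, hν⟩).trans ?_)
  have hr0' : (0 : ℝ) < r := by exact_mod_cast (by omega : 0 < r)
  have hmax : 0 < max ((h : ℝ) * r) |(t : ℝ)| := lt_max_of_lt_left (by positivity)
  set M := max ((h : ℝ) * r) |(t : ℝ)|
  have hK : (48 : ℝ) * 4 ^ ν ≤ Real.exp (48 * 4 ^ ν * E) := by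
    have h1 := Real.add_one_le_exp ((48 : ℝ) * 4 ^ ν * E)
    have h2 : (48 : ℝ) * 4 ^ ν * 1 ≤ 48 * 4 ^ ν * E := by gcongr
    linarith
  calc _ ≤ 2 * (Real.exp (C₁ * E) ^ ν * ((2 * h) ^ ν * (2 * Real.exp (C₁ * E)) ^ ν) *
        (24 * Real.exp (5 * E) * (h / M))) := by
        gcongr
        exact Real.one_add_le_exp_div_log hL
    _ = (h : ℝ) ^ (ν + 1) / M *
        (48 * 4 ^ ν * Real.exp (C₁ * E) ^ (2 * ν) * Real.exp (5 * E)) := by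
        rw [show (4 : ℝ) = 2 * 2 by norm_num, mul_pow, mul_pow, mul_pow]
        ring
    _ ≤ (h : ℝ) ^ (ν + 1) / M * (Real.exp (48 * 4 ^ ν * E) * Real.exp (C₁ * E) ^ (2 * ν) *
        Real.exp (5 * E)) := by gcongr
    _ = _ := by
        rw [← Real.exp_nat_mul, ← Real.exp_add, ← Real.exp_add, mul_div_assoc, ← hE]
        congr 2
        push_cast
        ring
end
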